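/- arXiv:2405.14041 — 5 statements merged into one kernel-verified Lean document; each statement's English description precedes it below -/
import Mathlib

section
/- The pattern sets {12345, 12354} and {45123, 45213} are Wilf-equivalent. -/
/-- A pattern is a permutation of `Fin k` for some `k : ℕ` (a permutation of length `k`,
written 0-indexed). -/
def Pattern : Type := Σ k : ℕ, Equiv.Perm (Fin k)

/-- Build a pattern from an explicit vector of values (0-indexed one-line notation). -/
noncomputable def mkPattern {k : ℕ} (v : Fin k → Fin k) (h : Function.Bijective v := by decide) : Pattern :=
  ⟨k, Equiv.ofBijective v h⟩

/-- The permutation `π` of length `n` contains an occurrence of the pattern `p`: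
there are indices `i₁ < ⋯ < i_k` (given by a strictly monotone `f`) such that
`π (f a) < π (f b) ↔ p a < p b` for all `a b`. -/
def PermContains {n : ℕ} (π : Equiv.Perm (Fin n)) (p : Pattern) : Prop :=
  ∃ f : Fin p.1 → Fin n, StrictMono f ∧
    ∀ a b : Fin p.1, π (f a) < π (f b) ↔ p.2 a < p.2 b

/-- `π` avoids every pattern in the set `S`. -/
def AvoidsSet {n : ℕ} (π : Equiv.Perm (Fin n)) (S : Set Pattern) : Prop :=
  ∀ p ∈ S, ¬ PermContains π p

/-- Two sets of patterns are Wilf-equivalent: for every `n ≥ 1`, the number of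
permutations of length `n` avoiding every pattern of `S1` equals the number of
permutations of length `n` avoiding every pattern of `S2`. -/
def WilfEquiv (S1 S2 : Set Pattern) : Prop :=
  ∀ n : ℕ, 1 ≤ n →
    Nat.card {π : Equiv.Perm (Fin n) // AvoidsSet π S1} =
    Nat.card {π : Equiv.Perm (Fin n) // AvoidsSet π S2}

namespace WilfProof

open Finset

section Lists

variable {α : Type*} [LinearOrder α]

/-- A list satisfying `P` occurs in `w` with all of its entries above `v`. -/
def OccursAbove (P : List α → Prop) (w : List α) (v : α) : Prop :=
  ∃ s, s.Sublist w ∧ P s ∧ ∀ y ∈ s, v < y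

variable {P : List α → Prop}

lemma OccursAbove.mono {w w' : List α} {v v' : α} (h : OccursAbove P w v) (hw : w.Sublist w')
    (hv : v' ≤ v) : OccursAbove P w' v' := by
  obtain ⟨s, hs, hP, hlt⟩ := h
  exact ⟨s, hs.trans hw, hP, fun y hy => hv.trans_lt (hlt y hy)⟩

open Classical in
/-- The entries of a list that do not have an occurrence of `P` above them and to their right. -/
noncomputable def core (P : List α → Prop) : List α → List α
  | [] => []
  | u :: w => if OccursAbove P w u then core P w else u :: core P w

lemma core_cons_of_occursAbove {w : List α} {u : α} (h : OccursAbove P w u) :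
    core P (u :: w) = core P w := by
  simp [core, h]

lemma core_cons_of_not_occursAbove {w : List α} {u : α} (h : ¬ OccursAbove P w u) :
    core P (u :: w) = u :: core P w := by
  simp [core, h]

lemma core_sublist (P : List α → Prop) (w : List α) : (core P w).Sublist w := by
  induction w with
  | nil => simp [core]
  | cons u w ih =>
    by_cases h : OccursAbove P w u
    · rw [core_cons_of_occursAbove h]
      exact ih.cons u
    · rw [core_cons_of_not_occursAbove h]
      exact ih.cons_cons u

lemma core_sublist_core_cons (P : List α → Prop) (u : α) (w : List α) :
    (core P w).Sublist (core P (u :: w)) := by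
  by_cases h : OccursAbove P w u
  · rw [core_cons_of_occursAbove h]
  · rw [core_cons_of_not_occursAbove h]
    exact List.sublist_cons_self _ _

lemma sublist_core_or_exists_occursAbove {s w : List α} (h : s.Sublist w) :
    s.Sublist (core P w) ∨ ∃ e ∈ s, OccursAbove P w e := by
  induction h with
  | slnil => simp [core]
  | @cons s w u h ih =>
    rcases ih with ih | ⟨e, he, hocc⟩
    · exact .inl (ih.trans (core_sublist_core_cons P u w))
    · exact .inr ⟨e, he, hocc.mono (List.sublist_cons_self _ _) le_rfl⟩
  | @cons_cons s w u h ih =>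
    by_cases hu : OccursAbove P w u
    · exact .inr ⟨u, by simp, hu.mono (List.sublist_cons_self _ _) le_rfl⟩
    rcases ih with ih | ⟨e, he, hocc⟩
    · rw [core_cons_of_not_occursAbove hu]
      exact .inl (ih.cons_cons u)
    · exact .inr ⟨e, by simp [he], hocc.mono (List.sublist_cons_self _ _) le_rfl⟩

lemma OccursAbove.core {w : List α} {v : α} (h : OccursAbove P w v) :
    OccursAbove P (core P w) v := by
  induction w generalizing v with
  | nil => simpa [WilfProof.core] using h
  | cons u w ih =>
    have key {v : α} (h : OccursAbove P w v) : OccursAbove P (WilfProof.core P (u :: w)) v :=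
      (ih h).mono (core_sublist_core_cons P u w) le_rfl
    obtain ⟨s, hs, hP, hlt⟩ := h
    rcases List.sublist_cons_iff.1 hs with hs | ⟨s, rfl, hs'⟩
    · exact key ⟨s, hs, hP, hlt⟩
    by_cases hu : OccursAbove P w u
    · exact key (hu.mono (List.Sublist.refl _) (hlt u (by simp)).le)
    rcases sublist_core_or_exists_occursAbove (P := P) hs' with hs' | ⟨e, he, hocc⟩
    · rw [core_cons_of_not_occursAbove hu]
      exact ⟨u :: s, hs'.cons_cons u, hP, hlt⟩
    · exact key (hocc.mono (List.Sublist.refl _) (hlt e (by simp [he])).le)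

lemma occursAbove_core_iff {w : List α} {v : α} :
    OccursAbove P (core P w) v ↔ OccursAbove P w v :=
  ⟨fun h => h.mono (core_sublist P w) le_rfl, fun h => h.core⟩

lemma mem_core_of_not_occursAbove {w : List α} {v : α} (hv : v ∈ w) (h : ¬ OccursAbove P w v) :
    v ∈ core P w := by
  rcases sublist_core_or_exists_occursAbove (P := P) (List.singleton_sublist.2 hv) with hs | hs
  · simpa using hs
  · simp [h] at hs

lemma mem_iff_mem_core {w : List α} {v : α} (h : ¬ OccursAbove P w v) :
    v ∈ w ↔ v ∈ core P w :=
  ⟨fun hv => mem_core_of_not_occursAbove hv h, fun hv => (core_sublist P w).subset hv⟩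

/-- An entry of `w`, preceded by `k` entries related to it by `r`, such that an occurrence of `P`
lies above and to the right of all these entries. -/
def HasBadEntry (P : List α → Prop) (r : α → α → Prop) (k : ℕ) (w : List α) : Prop :=
  ∃ l u s, l.length = k ∧ (l ++ u :: s).Sublist w ∧ P s ∧ (∀ x ∈ l, r x u) ∧
    ∀ y ∈ s, u < y ∧ ∀ x ∈ l, x < y

open Classical in
/-- The elements of `s` that have fewer than `k` elements of `s` related to them by `r`. -/
noncomputable def firstElements (r : α → α → Prop) (k : ℕ) (s : Finset α) : Finset α :=
  s.filter fun u => #{x ∈ s | r x u} < k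

lemma card_firstElements_lt {k : ℕ} (s : Finset α) : #(firstElements (· < ·) k s) = min k #s := by
  classical
  induction s using Finset.induction_on_max with
  | empty => simp [firstElements]
  | insert a s ha ih =>
    have has : a ∉ s := fun h => lt_irrefl _ (ha a h)
    have h1 : ({x ∈ insert a s | x < a} : Finset α) = s := by
      ext x; simp only [mem_filter, mem_insert]; constructor
      · rintro ⟨rfl | h, h'⟩
        · exact absurd h' (lt_irrefl _)
        · exact h
      · exact fun h => ⟨.inr h, ha x h⟩
    have h2 : s.filter (fun u => #{x ∈ insert a s | x < u} < k) = firstElements (· < ·) k s := by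
      refine filter_congr fun u hu => ?_
      rw [filter_insert, if_neg (ha u hu).not_gt]
      congr!
    rw [firstElements, filter_insert]
    by_cases hk : #s < k
    · rw [if_pos (by convert hk; convert h1), card_insert_of_notMem (by simp [has])]
      rw [card_insert_of_notMem has]
      have : #(filter (fun u => #{x ∈ insert a s | x < u} < k) s) = min k #s := by rw [h2, ih]
      convert congrArg (· + 1) this using 1
      · congr!
      · omega
    · rw [if_neg (by convert hk; convert h1), card_insert_of_notMem has]
      have : #(filter (fun u => #{x ∈ insert a s | x < u} < k) s) = min k #s := by rw [h2, ih]
      convert this using 1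
      · congr!
      · omega

lemma card_firstElements_gt {k : ℕ} (s : Finset α) : #(firstElements (· > ·) k s) = min k #s :=
  card_firstElements_lt (α := αᵒᵈ) s

variable [Fintype α]

open Classical in
/-- The entries that have an occurrence of `P` in `w` above them. -/
noncomputable def dominated (P : List α → Prop) (w : List α) : Finset α :=
  univ.filter (OccursAbove P w)

lemma mem_dominated {w : List α} {v : α} : v ∈ dominated P w ↔ OccursAbove P w v := by
  simp [dominated]

lemma dominated_core (w : List α) : dominated P (core P w) = dominated P w := by
  ext v
  simp [mem_dominated, occursAbove_core_iff]

open Classical in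
/-- The entries that may be prepended to `w` without creating a bad entry. -/
noncomputable def nextEntries (P : List α → Prop) (r : α → α → Prop) (k : ℕ) (w : List α) :
    Finset α :=
  univ.filter fun u => u ∉ w ∧
    (OccursAbove P w u → u ∈ firstElements r k (dominated P w \ w.toFinset))

/-- Prepending an entry to a list, as an embedding. -/
def consEmbedding (α : Type*) : (_ : List α) × α ↪ List α where
  toFun p := p.2 :: p.1
  inj' := by rintro ⟨w, u⟩ ⟨w', u'⟩ h; simp_all

lemma consEmbedding_apply {α : Type*} (w : List α) (u : α) : consEmbedding α ⟨w, u⟩ = u :: w := rfl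

/-- The lists of length `m` built by successively prepending permitted entries. -/
noncomputable def goodLists (P : List α → Prop) (r : α → α → Prop) (k : ℕ) :
    ℕ → Finset (List α)
  | 0 => {[]}
  | m + 1 => ((goodLists P r k m).sigma (nextEntries P r k)).map (consEmbedding α)

variable {r : α → α → Prop} {k : ℕ}

lemma mem_goodLists {m : ℕ} {w : List α} : w ∈ goodLists P r k m ↔
    w.length = m ∧ ∀ u t, (u :: t) <:+ w → u ∈ nextEntries P r k t := by
  induction m generalizing w with
  | zero =>
    simp only [goodLists, mem_singleton, List.length_eq_zero_iff]
    constructor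
    · rintro rfl
      simp
    · exact fun h => h.1
  | succ m ih =>
    simp only [goodLists, mem_map, mem_sigma, consEmbedding_apply, Sigma.exists]
    constructor
    · rintro ⟨t, u, ⟨ht, hu⟩, rfl⟩
      obtain ⟨hl, h⟩ := ih.1 ht
      refine ⟨by simp [hl], fun u' t' h' => ?_⟩
      rcases List.suffix_cons_iff.1 h' with h' | h'
      · obtain ⟨rfl, rfl⟩ := List.cons.inj h'
        exact hu
      · exact h _ _ h'
    · rintro ⟨hl, h⟩
      cases w with
      | nil => simp at hl
      | cons u t =>
        exact ⟨t, u, ⟨ih.2 ⟨by simpa using hl, fun u' t' h' => h _ _ (List.suffix_cons_iff.2 (.inr h'))⟩,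
          h _ _ List.suffix_rfl⟩, rfl⟩

lemma nodup_of_forall_suffix {w : List α}
    (h : ∀ u t, (u :: t) <:+ w → u ∈ nextEntries P r k t) : w.Nodup := by
  induction w with
  | nil => simp
  | cons u w ih =>
    refine List.nodup_cons.2 ⟨?_, ih fun u' t' h' => h _ _ (List.suffix_cons_iff.2 (.inr h'))⟩
    have := h _ _ List.suffix_rfl
    simp only [nextEntries, mem_filter] at this
    exact this.2.1

lemma card_dominated_sdiff {w : List α} (hw : w.Nodup) :
    #(dominated P w \ w.toFinset) =
      #(dominated P (core P w)) - (w.length - #((core P w).toFinset \ dominated P (core P w))) := by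
  rw [dominated_core]
  have h : (core P w).toFinset \ dominated P w = w.toFinset \ dominated P w := by
    ext v
    simp only [mem_sdiff, List.mem_toFinset, mem_dominated]
    exact and_congr_left fun hv => (mem_iff_mem_core hv).symm
  rw [h, ← List.toFinset_card_of_nodup hw]
  have h1 := card_sdiff_add_card_inter (dominated P w) w.toFinset
  have h2 := card_sdiff_add_card_inter w.toFinset (dominated P w)
  rw [inter_comm] at h2
  omega

lemma sum_nextEntries (hr : ∀ s : Finset α, #(firstElements r k s) = min k #s) {w : List α}
    (hw : w.Nodup) (f : List α → ℕ) :
    ∑ u ∈ nextEntries P r k w, f (core P (u :: w)) =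
      ∑ u ∈ univ \ (dominated P (core P w) ∪ (core P w).toFinset), f (u :: core P w) +
      min k (#(dominated P (core P w)) -
        (w.length - #((core P w).toFinset \ dominated P (core P w)))) * f (core P w) := by
  classical
  rw [← card_dominated_sdiff hw, ← hr, ← smul_eq_mul, ← sum_const,
    ← sum_filter_add_sum_filter_not _ (fun u => ¬ OccursAbove P w u)]
  congr 1
  · refine sum_congr ?_ fun u hu => ?_
    · ext u
      simp only [nextEntries, mem_filter, mem_sdiff, mem_union, mem_univ, true_and, dominated_core,
        mem_dominated, List.mem_toFinset, not_or]
      constructor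
      · rintro ⟨⟨h1, -⟩, h2⟩
        exact ⟨h2, fun h => h1 ((mem_iff_mem_core h2).2 h)⟩
      · rintro ⟨h2, h1⟩
        exact ⟨⟨fun h => h1 ((mem_iff_mem_core h2).1 h), fun h => absurd h h2⟩, h2⟩
    · simp only [mem_sdiff, mem_union, dominated_core, mem_dominated, not_or] at hu
      rw [core_cons_of_not_occursAbove hu.2.1]
  · refine sum_congr ?_ fun u hu => ?_
    · ext u
      simp only [nextEntries, mem_filter, mem_univ, true_and, not_not]
      constructor
      · exact fun h => h.1.2 h.2
      · intro h
        have h' := (mem_filter.1 h).1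
        simp only [mem_sdiff, mem_dominated, List.mem_toFinset] at h'
        exact ⟨⟨h'.2, fun _ => h⟩, h'.1⟩
    · have h' := (mem_filter.1 hu).1
      simp only [mem_sdiff, mem_dominated] at h'
      rw [core_cons_of_occursAbove h'.1]

lemma sum_goodLists_core_eq {r' : α → α → Prop}
    (hr : ∀ s : Finset α, #(firstElements r k s) = min k #s)
    (hr' : ∀ s : Finset α, #(firstElements r' k s) = min k #s) (m : ℕ) (f : List α → ℕ) :
    ∑ w ∈ goodLists P r k m, f (core P w) = ∑ w ∈ goodLists P r' k m, f (core P w) := by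
  induction m generalizing f with
  | zero => simp [goodLists]
  | succ m ih =>
    let g : List α → ℕ := fun x =>
      ∑ u ∈ univ \ (dominated P x ∪ x.toFinset), f (u :: x) +
        min k (#(dominated P x) - (m - #(x.toFinset \ dominated P x))) * f x
    have step {r : α → α → Prop} (hr : ∀ s : Finset α, #(firstElements r k s) = min k #s) :
        ∑ w ∈ goodLists P r k (m + 1), f (core P w) = ∑ w ∈ goodLists P r k m, g (core P w) := by
      rw [goodLists, sum_map, sum_sigma]
      refine sum_congr rfl fun w hw => ?_
      obtain ⟨hl, hw⟩ := mem_goodLists.1 hw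
      simpa [hl, g, consEmbedding_apply] using sum_nextEntries hr (nodup_of_forall_suffix hw) f
    exact (step hr).trans ((ih g).trans (step hr').symm)

lemma le_card_of_sublist {l p t : List α} {u : α} {s : List α} (hl : l.Sublist p)
    (hs : s.Sublist t) (hw : (p ++ u :: t).Nodup) (hP : P s) (hr : ∀ x ∈ l, r x u)
    (hlt : ∀ y ∈ s, u < y ∧ ∀ x ∈ l, x < y) : u ∉ nextEntries P r l.length t := by
  classical
  intro hu
  simp only [nextEntries, mem_filter, mem_univ, true_and] at hu
  have h := (mem_filter.1 (hu.2 ⟨s, hs, hP, fun y hy => (hlt y hy).1⟩)).2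
  refine h.not_ge ?_
  rw [List.nodup_append] at hw
  rw [← List.toFinset_card_of_nodup (hw.1.sublist hl)]
  refine card_le_card fun x hx => ?_
  rw [List.mem_toFinset] at hx
  simp only [mem_filter, mem_sdiff, mem_dominated, List.mem_toFinset]
  exact ⟨⟨⟨s, hs, hP, fun y hy => (hlt y hy).2 x hx⟩,
    fun h => hw.2.2 x (hl.subset hx) x (by simp [h]) rfl⟩, hr x hx⟩

lemma exists_of_notMem_nextEntries {p t : List α} {u : α} (hirr : ¬ r u u)
    (hmem : ∀ x, x ∈ p ++ u :: t) (hut : u ∉ t) (hu : u ∉ nextEntries P r k t) :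
    HasBadEntry P r k (p ++ u :: t) := by
  classical
  simp only [nextEntries, mem_filter, mem_univ, true_and, hut, not_false_eq_true,
    Classical.not_imp] at hu
  obtain ⟨hocc, hu⟩ := hu
  simp only [firstElements, mem_filter, mem_sdiff, mem_dominated, hocc, List.mem_toFinset, hut,
    not_false_eq_true, and_self, true_and, not_lt] at hu
  set F := {x ∈ dominated P t \ t.toFinset | r x u} with hF
  have hFmem {x : α} : x ∈ F ↔ (OccursAbove P t x ∧ x ∉ t) ∧ r x u := by
    simp [hF, mem_dominated]
  have hlen : k ≤ (p.filter (· ∈ F)).length := by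
    refine hu.trans ((card_le_card fun x hx => ?_).trans (List.toFinset_card_le _))
    have h := hFmem.1 hx
    have hxp := hmem x
    simp only [List.mem_append, List.mem_cons, h.1.2, or_false] at hxp
    rcases hxp with hxp | rfl
    · simp [hxp, hx]
    · exact absurd h.2 hirr
  set l := (p.filter (· ∈ F)).take k
  have hlp : l.Sublist p := (List.take_sublist _ _).trans List.filter_sublist
  have hlF : ∀ x ∈ l, x ∈ F := fun x hx => by
    simpa using (List.mem_filter.1 (List.mem_of_mem_take hx)).2
  obtain ⟨z, hz, hmax⟩ := (u :: l).toFinset.exists_max_image id ⟨u, by simp⟩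
  have hzocc : OccursAbove P t z := by
    simp only [List.toFinset_cons, mem_insert, List.mem_toFinset] at hz
    rcases hz with rfl | hz
    · exact hocc
    · exact (hFmem.1 (hlF z hz)).1.1
  obtain ⟨s, hs, hP, hlt⟩ := hzocc
  refine ⟨l, u, s, by simpa [l] using hlen, hlp.append (hs.cons_cons u), hP,
    fun x hx => (hFmem.1 (hlF x hx)).2, fun y hy => ⟨(hmax u (by simp)).trans_lt (hlt y hy),
      fun x hx => (hmax x (by simp [hx])).trans_lt (hlt y hy)⟩⟩

lemma not_hasBadEntry_iff {w : List α} (hirr : ∀ u, ¬ r u u) (hw : w.Nodup)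
    (hmem : ∀ x, x ∈ w) :
    ¬ HasBadEntry P r k w ↔ ∀ u t, (u :: t) <:+ w → u ∈ nextEntries P r k t := by
  constructor
  · rintro h u t ⟨p, rfl⟩
    by_contra hu
    have hut : u ∉ t := by
      rw [List.nodup_append] at hw
      exact (List.nodup_cons.1 hw.2.1).1
    exact h (exists_of_notMem_nextEntries (hirr u) hmem hut hu)
  · rintro h ⟨l, u, s, rfl, hsub, hP, hr, hlt⟩
    obtain ⟨q, q', rfl, hl, hus⟩ := List.append_sublist_iff.1 hsub
    obtain ⟨r₁, r₂, rfl, hu, hs⟩ := List.cons_sublist_iff.1 hus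
    obtain ⟨a, b, rfl⟩ := List.append_of_mem hu
    refine le_card_of_sublist (p := q ++ a) (t := b ++ r₂)
      (hl.trans (List.sublist_append_left _ _)) (hs.trans (List.sublist_append_right _ _))
      (by simpa using hw) hP hr hlt (h _ _ ⟨q ++ a, by simp⟩)

end Lists

section Permutations

variable {n : ℕ}

lemma card_perm_not_hasBadEntry {P : List (Fin n) → Prop} {r : Fin n → Fin n → Prop} {k : ℕ}
    (hirr : ∀ u, ¬ r u u) :
    Nat.card {π : Equiv.Perm (Fin n) // ¬ HasBadEntry P r k (List.ofFn π)} =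
      #(goodLists P r k n) := by
  have good_iff (π : Equiv.Perm (Fin n)) :
      ¬ HasBadEntry P r k (List.ofFn π) ↔ List.ofFn π ∈ goodLists P r k n := by
    rw [mem_goodLists, not_hasBadEntry_iff hirr (List.nodup_ofFn.2 π.injective)
      fun x => (List.mem_ofFn' _ _).2 (π.surjective x)]
    simp
  rw [← Nat.card_eq_finsetCard]
  refine Nat.card_eq_of_bijective
    (fun π => (⟨List.ofFn π.1, (good_iff π.1).1 π.2⟩ : goodLists P r k n)) ⟨?_, ?_⟩
  · intro π σ h
    have h := List.ofFn_injective (congrArg Subtype.val h)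
    exact Subtype.ext (DFunLike.coe_injective h)
  · rintro ⟨w, hw⟩
    obtain ⟨hl, h⟩ := mem_goodLists.1 hw
    obtain ⟨f, rfl⟩ : ∃ f : Fin n → Fin n, List.ofFn f = w :=
      ⟨fun i => w.get (i.cast hl.symm), List.ext_get (by simp [hl]) (by simp)⟩
    have hf := Finite.injective_iff_bijective.1 (List.nodup_ofFn.1 (nodup_of_forall_suffix h))
    exact ⟨⟨Equiv.ofBijective f hf, (good_iff (Equiv.ofBijective f hf)).2 hw⟩, rfl⟩

/-- In the list of values of a permutation, the entries of each bad entry of ascending type may be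
reversed to descending type without changing the number of permutations avoiding them. -/
theorem card_not_hasBadEntry_lt_eq_gt (P : List (Fin n) → Prop) (k : ℕ) :
    Nat.card {π : Equiv.Perm (Fin n) // ¬ HasBadEntry P (· < ·) k (List.ofFn π)} =
      Nat.card {π : Equiv.Perm (Fin n) // ¬ HasBadEntry P (· > ·) k (List.ofFn π)} := by
  rw [card_perm_not_hasBadEntry lt_irrefl,
    card_perm_not_hasBadEntry (r := (· > ·)) fun u => lt_irrefl u]
  simpa using sum_goodLists_core_eq card_firstElements_lt card_firstElements_gt n fun _ => 1

lemma permContains_iff_exists_sublist {k : ℕ} (π : Equiv.Perm (Fin n)) (p : Equiv.Perm (Fin k)) :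
    PermContains π ⟨k, p⟩ ↔ ∃ s : Fin k → Fin n, (List.ofFn s).Sublist (List.ofFn π) ∧
      ∀ a b, s a < s b ↔ p a < p b := by
  constructor
  · rintro ⟨f, hf, h⟩
    refine ⟨π ∘ f, ?_, h⟩
    rw [List.sublist_iff_exists_fin_orderEmbedding_get_eq]
    exact ⟨(Fin.castOrderIso List.length_ofFn).toOrderEmbedding.trans
      ((OrderEmbedding.ofStrictMono f hf).trans
        (Fin.castOrderIso List.length_ofFn.symm).toOrderEmbedding), fun i => by simp; rfl⟩
  · rintro ⟨s, hs, h⟩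
    obtain ⟨f, hf⟩ := List.sublist_iff_exists_fin_orderEmbedding_get_eq.1 hs
    let g : Fin k ↪o Fin n := (Fin.castOrderIso List.length_ofFn.symm).toOrderEmbedding.trans
      (f.trans (Fin.castOrderIso List.length_ofFn).toOrderEmbedding)
    have hg (i : Fin k) : π (g i) = s i := by
      have := hf (Fin.cast List.length_ofFn.symm i)
      simp only [List.get_ofFn] at this
      exact this.symm
    exact ⟨g, g.strictMono, fun a b => by rw [hg, hg]; exact h a b⟩

lemma permContains_symm {k : ℕ} {π : Equiv.Perm (Fin n)} {p : Equiv.Perm (Fin k)}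
    (h : PermContains π ⟨k, p⟩) : PermContains π.symm ⟨k, p.symm⟩ := by
  obtain ⟨f, hf, h⟩ := h
  refine ⟨fun a => π (f (p.symm a)), fun a b hab => ?_, fun a b => ?_⟩
  · simpa [h] using hab
  · simp [hf.lt_iff_lt]

lemma permContains_revPerm_mul {k : ℕ} {π : Equiv.Perm (Fin n)} {p : Equiv.Perm (Fin k)}
    (h : PermContains π ⟨k, p⟩) : PermContains (Fin.revPerm * π) ⟨k, Fin.revPerm * p⟩ := by
  obtain ⟨f, hf, h⟩ := h
  exact ⟨f, hf, fun a b => by simpa using h b a⟩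

lemma permContains_mul_revPerm {k : ℕ} {π : Equiv.Perm (Fin n)} {p : Equiv.Perm (Fin k)}
    (h : PermContains π ⟨k, p⟩) : PermContains (π * Fin.revPerm) ⟨k, p * Fin.revPerm⟩ := by
  obtain ⟨f, hf, h⟩ := h
  exact ⟨fun a => (f a.rev).rev, fun a b hab => by simpa using hf (Fin.rev_lt_rev.2 hab),
    fun a b => by simpa using h a.rev b.rev⟩

lemma revPerm_mul_revPerm_mul {m : ℕ} (σ : Equiv.Perm (Fin m)) :
    Fin.revPerm * (Fin.revPerm * σ) = σ := by
  ext a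
  simp

lemma mul_revPerm_mul_revPerm {m : ℕ} (σ : Equiv.Perm (Fin m)) :
    σ * Fin.revPerm * Fin.revPerm = σ := by
  ext a
  simp

lemma permContains_revPerm_mul_iff {k : ℕ} {π : Equiv.Perm (Fin n)} {p : Equiv.Perm (Fin k)} :
    PermContains (Fin.revPerm * π) ⟨k, Fin.revPerm * p⟩ ↔ PermContains π ⟨k, p⟩ :=
  ⟨fun h => by simpa only [revPerm_mul_revPerm_mul] using permContains_revPerm_mul h,
    permContains_revPerm_mul⟩

lemma permContains_mul_revPerm_iff {k : ℕ} {π : Equiv.Perm (Fin n)} {p : Equiv.Perm (Fin k)} :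
    PermContains (π * Fin.revPerm) ⟨k, p * Fin.revPerm⟩ ↔ PermContains π ⟨k, p⟩ :=
  ⟨fun h => by simpa only [mul_revPerm_mul_revPerm] using permContains_mul_revPerm h,
    permContains_mul_revPerm⟩

lemma permContains_symm_iff {k : ℕ} {π : Equiv.Perm (Fin n)} {p : Equiv.Perm (Fin k)} :
    PermContains π.symm ⟨k, p.symm⟩ ↔ PermContains π ⟨k, p⟩ :=
  ⟨permContains_symm, permContains_symm⟩

/-- The reverse-complement of a permutation, as an equivalence. -/
def reverseComplement (n : ℕ) : Equiv.Perm (Fin n) ≃ Equiv.Perm (Fin n) :=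
  (Equiv.mulLeft Fin.revPerm).trans (Equiv.mulRight Fin.revPerm)

/-- The complement of the inverse of a permutation, as an equivalence. -/
def inverseComplement (n : ℕ) : Equiv.Perm (Fin n) ≃ Equiv.Perm (Fin n) :=
  (Equiv.inv _).trans (Equiv.mulLeft Fin.revPerm)

lemma permContains_reverseComplement_iff {k : ℕ} {v v' : Fin k → Fin k} {hv : v.Bijective}
    {hv' : v'.Bijective} (h : ∀ a, v' a = (v a.rev).rev) (π : Equiv.Perm (Fin n)) :
    PermContains (reverseComplement n π) (mkPattern v' hv') ↔ PermContains π (mkPattern v hv) := by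
  have hp : Equiv.ofBijective v' hv' = Fin.revPerm * Equiv.ofBijective v hv * Fin.revPerm := by
    ext a
    simp [h]
  rw [mkPattern, hp]
  exact permContains_mul_revPerm_iff.trans permContains_revPerm_mul_iff

lemma permContains_inverseComplement_iff {k : ℕ} {v v' : Fin k → Fin k} {hv : v.Bijective}
    {hv' : v'.Bijective} (h : ∀ a, v' (v a) = a.rev) (π : Equiv.Perm (Fin n)) :
    PermContains (inverseComplement n π) (mkPattern v' hv') ↔ PermContains π (mkPattern v hv) := by
  have hp : Equiv.ofBijective v' hv' = Fin.revPerm * (Equiv.ofBijective v hv).symm := by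
    ext a
    obtain ⟨b, rfl⟩ := hv.2 a
    have hb : (Equiv.ofBijective v hv).symm (v b) = b :=
      (Equiv.ofBijective v hv).symm_apply_apply b
    simp [h, hb]
  rw [mkPattern, hp]
  exact permContains_revPerm_mul_iff.trans permContains_symm_iff

lemma avoidsSet_pair {π : Equiv.Perm (Fin n)} {p q : Pattern} :
    AvoidsSet π {p, q} ↔ ¬ (PermContains π p ∨ PermContains π q) := by
  simp [AvoidsSet]

lemma wilfEquiv_of_equiv {p q p' q' : Pattern}
    (e : ∀ n, Equiv.Perm (Fin n) ≃ Equiv.Perm (Fin n))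
    (hp : ∀ n (π : Equiv.Perm (Fin n)), PermContains (e n π) p' ↔ PermContains π p)
    (hq : ∀ n (π : Equiv.Perm (Fin n)), PermContains (e n π) q' ↔ PermContains π q) :
    WilfEquiv {p, q} {p', q'} := fun n _ =>
  Nat.card_congr ((e n).subtypeEquiv fun π => by rw [avoidsSet_pair, avoidsSet_pair, hp, hq])

lemma wilfEquiv_of_hasBadEntry {p q p' q' : Pattern} (k : ℕ) (P : ∀ n, List (Fin n) → Prop)
    (h : ∀ n (π : Equiv.Perm (Fin n)), HasBadEntry (P n) (· < ·) k (List.ofFn π) ↔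
      PermContains π p ∨ PermContains π q)
    (h' : ∀ n (π : Equiv.Perm (Fin n)), HasBadEntry (P n) (· > ·) k (List.ofFn π) ↔
      PermContains π p' ∨ PermContains π q') :
    WilfEquiv {p, q} {p', q'} := fun n _ => by
  simpa only [avoidsSet_pair, h, h'] using card_not_hasBadEntry_lt_eq_gt (P n) k

lemma wilfEquiv_trans {S T U : Set Pattern} (h : WilfEquiv S T) (h' : WilfEquiv T U) :
    WilfEquiv S U :=
  fun n hn => (h n hn).trans (h' n hn)

lemma permContains_mkPattern_iff {v : Fin 5 → Fin 5} {hv : v.Bijective}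
    {π : Equiv.Perm (Fin n)} : PermContains π (mkPattern v hv) ↔ ∃ a b c d e : Fin n,
      [a, b, c, d, e].Sublist (List.ofFn π) ∧
        ∀ i j, ![a, b, c, d, e] i < ![a, b, c, d, e] j ↔ v i < v j := by
  rw [mkPattern, permContains_iff_exists_sublist]
  constructor
  · rintro ⟨s, hs, h⟩
    have hs' : s = ![s 0, s 1, s 2, s 3, s 4] := by
      ext i
      fin_cases i <;> rfl
    refine ⟨s 0, s 1, s 2, s 3, s 4, by simpa using hs, ?_⟩
    rw [← hs']
    exact h
  · rintro ⟨a, b, c, d, e, hs, h⟩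
    exact ⟨![a, b, c, d, e], by simpa using hs, h⟩

/-- Lists that consist of two increasing entries. -/
def IsAscent (s : List (Fin n)) : Prop := ∃ d e, s = [d, e] ∧ d < e

/-- Lists that consist of three entries of which the first is the largest. -/
def IsPeak (s : List (Fin n)) : Prop := ∃ c d e, s = [c, d, e] ∧ d < c ∧ e < c

lemma nodup_of_sublist_ofFn {π : Equiv.Perm (Fin n)} {s : List (Fin n)}
    (h : s.Sublist (List.ofFn π)) : s.Nodup :=
  (List.nodup_ofFn.2 π.injective).sublist h

lemma hasBadEntry_isAscent_lt_iff (π : Equiv.Perm (Fin n)) :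
    HasBadEntry IsAscent (· < ·) 2 (List.ofFn π) ↔
      PermContains π (mkPattern ![0, 1, 2, 3, 4]) ∨ PermContains π (mkPattern ![1, 0, 2, 3, 4]) := by
  simp only [permContains_mkPattern_iff]
  constructor
  · rintro ⟨l, u, _, hl, hs, ⟨d, e, rfl, hde⟩, hr, hlt⟩
    obtain ⟨a, b, rfl⟩ := List.length_eq_two.1 hl
    have hab : a ≠ b := by
      have := nodup_of_sublist_ofFn hs
      simp_all
    simp at hr hlt
    rcases hab.lt_or_gt with hab | hab
    · refine .inl ⟨a, b, u, d, e, hs, ?_⟩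
      simp [Fin.forall_fin_succ]
      omega
    · refine .inr ⟨a, b, u, d, e, hs, ?_⟩
      simp [Fin.forall_fin_succ]
      omega
  · rintro (⟨a, b, u, d, e, hs, h⟩ | ⟨a, b, u, d, e, hs, h⟩)
    all_goals
      simp [Fin.forall_fin_succ] at h
      refine ⟨[a, b], u, [d, e], rfl, hs, ⟨d, e, rfl, ?_⟩, ?_⟩
      · omega
      · simp
        omega

lemma hasBadEntry_isAscent_gt_iff (π : Equiv.Perm (Fin n)) :
    HasBadEntry IsAscent (· > ·) 2 (List.ofFn π) ↔
      PermContains π (mkPattern ![1, 2, 0, 3, 4]) ∨ PermContains π (mkPattern ![2, 1, 0, 3, 4]) := by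
  simp only [permContains_mkPattern_iff]
  constructor
  · rintro ⟨l, u, _, hl, hs, ⟨d, e, rfl, hde⟩, hr, hlt⟩
    obtain ⟨a, b, rfl⟩ := List.length_eq_two.1 hl
    have hab : a ≠ b := by
      have := nodup_of_sublist_ofFn hs
      simp_all
    simp at hr hlt
    rcases hab.lt_or_gt with hab | hab
    · refine .inl ⟨a, b, u, d, e, hs, ?_⟩
      simp [Fin.forall_fin_succ]
      omega
    · refine .inr ⟨a, b, u, d, e, hs, ?_⟩
      simp [Fin.forall_fin_succ]
      omega
  · rintro (⟨a, b, u, d, e, hs, h⟩ | ⟨a, b, u, d, e, hs, h⟩)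
    all_goals
      simp [Fin.forall_fin_succ] at h
      refine ⟨[a, b], u, [d, e], rfl, hs, ⟨d, e, rfl, ?_⟩, ?_⟩
      · omega
      · simp
        omega

lemma hasBadEntry_isPeak_lt_iff (π : Equiv.Perm (Fin n)) :
    HasBadEntry IsPeak (· < ·) 1 (List.ofFn π) ↔
      PermContains π (mkPattern ![0, 1, 4, 3, 2]) ∨ PermContains π (mkPattern ![0, 1, 4, 2, 3]) := by
  simp only [permContains_mkPattern_iff]
  constructor
  · rintro ⟨l, u, _, hl, hs, ⟨c, d, e, rfl, hdc, hec⟩, hr, hlt⟩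
    obtain ⟨a, rfl⟩ := List.length_eq_one_iff.1 hl
    have hde : d ≠ e := by
      have := nodup_of_sublist_ofFn hs
      simp_all
    simp at hr hlt
    rcases hde.lt_or_gt with hde | hde
    · refine .inr ⟨a, u, c, d, e, hs, ?_⟩
      simp [Fin.forall_fin_succ]
      omega
    · refine .inl ⟨a, u, c, d, e, hs, ?_⟩
      simp [Fin.forall_fin_succ]
      omega
  · rintro (⟨a, u, c, d, e, hs, h⟩ | ⟨a, u, c, d, e, hs, h⟩)
    all_goals
      simp [Fin.forall_fin_succ] at h
      refine ⟨[a], u, [c, d, e], rfl, hs, ⟨c, d, e, rfl, ?_, ?_⟩, ?_⟩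
      · omega
      · omega
      · simp
        omega

lemma hasBadEntry_isPeak_gt_iff (π : Equiv.Perm (Fin n)) :
    HasBadEntry IsPeak (· > ·) 1 (List.ofFn π) ↔
      PermContains π (mkPattern ![1, 0, 4, 3, 2]) ∨ PermContains π (mkPattern ![1, 0, 4, 2, 3]) := by
  simp only [permContains_mkPattern_iff]
  constructor
  · rintro ⟨l, u, _, hl, hs, ⟨c, d, e, rfl, hdc, hec⟩, hr, hlt⟩
    obtain ⟨a, rfl⟩ := List.length_eq_one_iff.1 hl
    have hde : d ≠ e := by
      have := nodup_of_sublist_ofFn hs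
      simp_all
    simp at hr hlt
    rcases hde.lt_or_gt with hde | hde
    · refine .inr ⟨a, u, c, d, e, hs, ?_⟩
      simp [Fin.forall_fin_succ]
      omega
    · refine .inl ⟨a, u, c, d, e, hs, ?_⟩
      simp [Fin.forall_fin_succ]
      omega
  · rintro (⟨a, u, c, d, e, hs, h⟩ | ⟨a, u, c, d, e, hs, h⟩)
    all_goals
      simp [Fin.forall_fin_succ] at h
      refine ⟨[a], u, [c, d, e], rfl, hs, ⟨c, d, e, rfl, ?_, ?_⟩, ?_⟩
      · omega
      · omega
      · simp
        omega

end Permutations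

end WilfProof

open WilfProof

/-- The pattern sets {12345, 12354} and {45123, 45213} are Wilf-equivalent. -/
theorem stmt0 : WilfEquiv {mkPattern ![0,1,2,3,4], mkPattern ![0,1,2,4,3]} {mkPattern ![3,4,0,1,2], mkPattern ![3,4,1,0,2]} := by
  have reverseComplement_ascending : WilfEquiv
      {mkPattern ![0, 1, 2, 3, 4], mkPattern ![0, 1, 2, 4, 3]}
      {mkPattern ![0, 1, 2, 3, 4], mkPattern ![1, 0, 2, 3, 4]} :=
    wilfEquiv_of_equiv reverseComplement
      (fun _ => permContains_reverseComplement_iff (by decide))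
      (fun _ => permContains_reverseComplement_iff (by decide))
  have ascent : WilfEquiv
      {mkPattern ![0, 1, 2, 3, 4], mkPattern ![1, 0, 2, 3, 4]}
      {mkPattern ![1, 2, 0, 3, 4], mkPattern ![2, 1, 0, 3, 4]} :=
    wilfEquiv_of_hasBadEntry 2 (fun _ => IsAscent)
      (fun _ => hasBadEntry_isAscent_lt_iff) (fun _ => hasBadEntry_isAscent_gt_iff)
  have reverseComplement_descending : WilfEquiv
      {mkPattern ![2, 1, 0, 3, 4], mkPattern ![1, 2, 0, 3, 4]}
      {mkPattern ![0, 1, 4, 3, 2], mkPattern ![0, 1, 4, 2, 3]} :=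
    wilfEquiv_of_equiv reverseComplement
      (fun _ => permContains_reverseComplement_iff (by decide))
      (fun _ => permContains_reverseComplement_iff (by decide))
  have peak : WilfEquiv
      {mkPattern ![0, 1, 4, 3, 2], mkPattern ![0, 1, 4, 2, 3]}
      {mkPattern ![1, 0, 4, 3, 2], mkPattern ![1, 0, 4, 2, 3]} :=
    wilfEquiv_of_hasBadEntry 1 (fun _ => IsPeak)
      (fun _ => hasBadEntry_isPeak_lt_iff) (fun _ => hasBadEntry_isPeak_gt_iff)
  have inverseComplement_peak : WilfEquiv
      {mkPattern ![1, 0, 4, 3, 2], mkPattern ![1, 0, 4, 2, 3]}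
      {mkPattern ![3, 4, 0, 1, 2], mkPattern ![3, 4, 1, 0, 2]} :=
    wilfEquiv_of_equiv inverseComplement
      (fun _ => permContains_inverseComplement_iff (by decide))
      (fun _ => permContains_inverseComplement_iff (by decide))
  rw [Set.pair_comm (mkPattern ![2, 1, 0, 3, 4])] at reverseComplement_descending
  exact wilfEquiv_trans reverseComplement_ascending (wilfEquiv_trans ascent
    (wilfEquiv_trans reverseComplement_descending (wilfEquiv_trans peak inverseComplement_peak)))
end

section
/- The pattern sets {12345, 21345} and {31254, 32154} are Wilf-equivalent. -/
open Finset

section SequentialChoice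

variable {α : Type*} [DecidableEq α]

/-- The elements of `S v` not yet chosen by `f` before step `v`. -/
def avail {r : ℕ} (S : Fin r → Finset α) (f : Fin r → α) (v : Fin r) : Finset α :=
  S v \ (univ.filter (· < v)).image f

/-- Sequences of successive choices `f v` among the available elements of `S v`, each one
admissible for `Q`. -/
def IsChoice (Q : Finset α → α → Prop) {r : ℕ} (S : Fin r → Finset α) (f : Fin r → α) : Prop :=
  ∀ v, f v ∈ avail S f v ∧ Q (avail S f v) (f v)

lemma avail_cons_zero {r : ℕ} (S : Fin (r + 1) → Finset α) (f : Fin (r + 1) → α) :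
    avail S f 0 = S 0 := by
  simp [avail]

lemma avail_cons_succ {r : ℕ} (S : Fin (r + 1) → Finset α) (x : α) (f : Fin r → α) (v : Fin r) :
    avail S (Fin.cons x f) v.succ = avail (fun w => (S w.succ).erase x) f v := by
  ext y
  simp only [avail, mem_sdiff, mem_image, mem_filter, mem_univ, true_and, mem_erase,
    Fin.exists_fin_succ, Fin.cons_zero, Fin.cons_succ, Fin.succ_pos, Fin.succ_lt_succ_iff]
  grind

lemma isChoice_cons {Q : Finset α → α → Prop} {r : ℕ} {S : Fin (r + 1) → Finset α} {x : α}
    {f : Fin r → α} :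
    IsChoice Q S (Fin.cons x f) ↔
      (x ∈ S 0 ∧ Q (S 0) x) ∧ IsChoice Q (fun w => (S w.succ).erase x) f := by
  simp only [IsChoice, Fin.forall_fin_succ, avail_cons_zero, avail_cons_succ, Fin.cons_zero,
    Fin.cons_succ]

open Classical in
lemma card_isChoice_succ [Fintype α] (Q : Finset α → α → Prop) {r : ℕ}
    (S : Fin (r + 1) → Finset α) :
    #{f | IsChoice Q S f} =
      ∑ x ∈ S 0 with Q (S 0) x, #{f | IsChoice Q (fun w => (S w.succ).erase x) f} := by
  rw [← card_sigma]
  refine card_bij' (fun f _ => ⟨f 0, Fin.tail f⟩) (fun p _ => Fin.cons p.1 p.2) ?_ ?_ ?_ ?_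
  · intro f hf
    rw [mem_filter, ← Fin.cons_self_tail f, isChoice_cons] at hf
    simpa using hf
  · rintro ⟨x, f⟩ hf
    simpa [isChoice_cons] using hf
  · intro f _
    exact Fin.cons_self_tail f
  · rintro ⟨x, f⟩ _
    simp

open Classical in
/-- For a laminar family, the number of admissible sequences of choices only depends on how many
admissible elements a set of each size has. -/
theorem card_isChoice_eq [Fintype α] {Q Q' : Finset α → α → Prop} {g : ℕ → ℕ}
    (hQ : ∀ S, #{x ∈ S | Q S x} = g #S) (hQ' : ∀ S, #{x ∈ S | Q' S x} = g #S) {r : ℕ}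
    (S S' : Fin r → Finset α) (hcard : ∀ v, #(S v) = #(S' v))
    (hS : ∀ v w, v < w →
      (S v ⊆ S w ∧ S' v ⊆ S' w) ∨ (Disjoint (S v) (S w) ∧ Disjoint (S' v) (S' w))) :
    #{f | IsChoice Q S f} = #{f | IsChoice Q' S' f} := by
  induction r with
  | zero => simp [IsChoice]
  | succ r ih =>
    rw [card_isChoice_succ, card_isChoice_succ]
    have key : ∀ x ∈ S 0, ∀ y ∈ S' 0, #{f | IsChoice Q (fun w => (S w.succ).erase x) f} =
        #{f | IsChoice Q' (fun w => (S' w.succ).erase y) f} := by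
      intro x hx y hy
      apply ih
      · intro v
        rcases hS 0 v.succ (Fin.succ_pos v) with h | h
        · rw [card_erase_of_mem (h.1 hx), card_erase_of_mem (h.2 hy), hcard]
        · rw [erase_eq_of_notMem (disjoint_left.1 h.1 hx),
            erase_eq_of_notMem (disjoint_left.1 h.2 hy), hcard]
      · intro v w hvw
        rcases hS v.succ w.succ (Fin.succ_lt_succ_iff.2 hvw) with h | h
        · exact .inl ⟨erase_subset_erase _ h.1, erase_subset_erase _ h.2⟩
        · exact .inr ⟨h.1.mono (erase_subset _ _) (erase_subset _ _),
            h.2.mono (erase_subset _ _) (erase_subset _ _)⟩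
    have e : #{x ∈ S 0 | Q (S 0) x} = #{x ∈ S' 0 | Q' (S' 0) x} := by rw [hQ, hQ', hcard]
    rcases (S' 0).eq_empty_or_nonempty with h | ⟨y, hy⟩
    · have h' : S 0 = ∅ := by rw [← card_eq_zero, hcard, h, card_empty]
      simp [h, h']
    rcases (S 0).eq_empty_or_nonempty with h | ⟨x, hx⟩
    · have h' : S' 0 = ∅ := by rw [← card_eq_zero, ← hcard, h, card_empty]
      simp [h, h']
    rw [sum_congr rfl fun a ha => key a (mem_filter.1 ha).1 y hy,
      sum_congr rfl fun b hb => (key x hx b (mem_filter.1 hb).1).symm, sum_const, sum_const, e,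
      key x hx y hy]

end SequentialChoice

section Ranks

variable {α : Type*} [LinearOrder α]

lemma card_rank_lt (m : ℕ) (S : Finset α) :
    #{x ∈ S | #{k ∈ S | k < x} < m} = min m #S := by
  induction S using Finset.induction_on_max with
  | empty => simp
  | insert a S ha ih =>
    have haS : a ∉ S := fun h => lt_irrefl _ (ha a h)
    have h1 : {k ∈ insert a S | k < a} = S := by
      ext k; simp only [mem_filter, mem_insert]; grind
    have h2 : {x ∈ S | #{k ∈ insert a S | k < x} < m} = {x ∈ S | #{k ∈ S | k < x} < m} := by
      refine filter_congr fun x hx => ?_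
      rw [filter_insert, if_neg (ha x hx).not_gt]
    rw [filter_insert, h1, h2, card_insert_of_notMem haS]
    split_ifs with h
    · rw [card_insert_of_notMem (by simp [haS]), ih]; omega
    · rw [ih]; omega

lemma card_corank_lt (m : ℕ) (S : Finset α) :
    #{x ∈ S | #{k ∈ S | x < k} < m} = min m #S :=
  card_rank_lt (α := αᵒᵈ) m S

end Ranks

section Shadow

variable {n : ℕ}

/-- The cells lying strictly south-west of every point of some member of `C` contained in `R`. -/
def neShadow (C : Set (Set (Fin n × Fin n))) (R : Set (Fin n × Fin n)) : Set (Fin n × Fin n) :=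
  {c | ∃ t ∈ C, t ⊆ R ∧ ∀ p ∈ t, c.1 < p.1 ∧ c.2 < p.2}

/-- The points of the diagram of `π`. -/
def diagram (π : Equiv.Perm (Fin n)) : Set (Fin n × Fin n) := {p | π p.1 = p.2}

/-- The points of the diagram of `π` outside its shadow. -/
def outer (C : Set (Set (Fin n × Fin n))) (π : Equiv.Perm (Fin n)) : Set (Fin n × Fin n) :=
  diagram π \ neShadow C (diagram π)

lemma neShadow_mono (C : Set (Set (Fin n × Fin n))) {R R' : Set (Fin n × Fin n)} (h : R ⊆ R') :
    neShadow C R ⊆ neShadow C R' :=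
  fun _ ⟨t, ht, hR, hp⟩ => ⟨t, ht, hR.trans h, hp⟩

lemma neShadow_of_le {C : Set (Set (Fin n × Fin n))} {R : Set (Fin n × Fin n)} {c d : Fin n × Fin n}
    (hc : c ∈ neShadow C R) (h : d ≤ c) : d ∈ neShadow C R := by
  obtain ⟨t, ht, hR, hp⟩ := hc
  exact ⟨t, ht, hR, fun p hpt => ⟨h.1.trans_lt (hp p hpt).1, h.2.trans_lt (hp p hpt).2⟩⟩

/-- A shadow is already cast by the points outside it. -/
lemma neShadow_sdiff_neShadow (C : Set (Set (Fin n × Fin n))) (R : Set (Fin n × Fin n)) :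
    neShadow C (R \ neShadow C R) = neShadow C R := by
  refine (neShadow_mono C Set.sdiff_subset).antisymm fun c hc => ?_
  obtain ⟨d, hcd, hd⟩ := (Set.toFinite (neShadow C R)).exists_le_maximal hc
  obtain ⟨t, ht, hR, hp⟩ := hd.prop
  refine neShadow_of_le ⟨t, ht, fun p hpt => ⟨hR hpt, fun hpF => ?_⟩, hp⟩ hcd
  have := hd.le_of_ge hpF ⟨(hp p hpt).1.le, (hp p hpt).2.le⟩
  exact (hp p hpt).1.not_ge this.1

lemma neShadow_outer (C : Set (Set (Fin n × Fin n))) (π : Equiv.Perm (Fin n)) :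
    neShadow C (outer C π) = neShadow C (diagram π) :=
  neShadow_sdiff_neShadow C _

open Classical in
/-- The columns in which a permutation with the same outer points as `π` may have its entry `v`. -/
noncomputable def columns (C : Set (Set (Fin n × Fin n))) (π : Equiv.Perm (Fin n)) (v : Fin n) :
    Finset (Fin n) :=
  if (π.symm v, v) ∈ neShadow C (diagram π) then
    univ.filter fun c => (c, v) ∈ neShadow C (diagram π) ∧ (c, π c) ∈ neShadow C (diagram π)
  else {π.symm v}

lemma mem_columns_of_mem {C : Set (Set (Fin n × Fin n))} {π : Equiv.Perm (Fin n)} {v c : Fin n}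
    (h : (π.symm v, v) ∈ neShadow C (diagram π)) :
    c ∈ columns C π v ↔ (c, v) ∈ neShadow C (diagram π) ∧ (c, π c) ∈ neShadow C (diagram π) := by
  simp [columns, h]

lemma columns_of_notMem {C : Set (Set (Fin n × Fin n))} {π : Equiv.Perm (Fin n)} {v : Fin n}
    (h : (π.symm v, v) ∉ neShadow C (diagram π)) : columns C π v = {π.symm v} := by
  simp [columns, h]

lemma columns_laminar (C : Set (Set (Fin n × Fin n))) (π : Equiv.Perm (Fin n)) {v w : Fin n}
    (hvw : w < v) :
    columns C π v ⊆ columns C π w ∨ Disjoint (columns C π v) (columns C π w) := by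
  by_cases hv : (π.symm v, v) ∈ neShadow C (diagram π) <;>
    by_cases hw : (π.symm w, w) ∈ neShadow C (diagram π)
  · left
    intro c hc
    rw [mem_columns_of_mem hv] at hc
    rw [mem_columns_of_mem hw]
    exact ⟨neShadow_of_le hc.1 ⟨le_rfl, hvw.le⟩, hc.2⟩
  · right
    rw [columns_of_notMem hw, disjoint_singleton_right, mem_columns_of_mem hv]
    intro h
    exact hw (by simpa using h.2)
  · right
    rw [columns_of_notMem hv, disjoint_singleton_left, mem_columns_of_mem hw]
    intro h
    exact hv (by simpa using h.2)
  · right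
    rw [columns_of_notMem hv, columns_of_notMem hw]
    simpa using hvw.ne'

lemma mem_diagram_iff {π : Equiv.Perm (Fin n)} {v c : Fin n} :
    (c, v) ∈ diagram π ↔ c = π.symm v := by
  rw [Equiv.eq_symm_apply]; rfl

/-- The permutations with the same outer points as `π` are those whose points lie in the
prescribed columns. -/
lemma outer_eq_iff {C : Set (Set (Fin n × Fin n))} {π ρ : Equiv.Perm (Fin n)} :
    outer C ρ = outer C π ↔ ∀ v, ρ.symm v ∈ columns C π v := by
  constructor
  · intro h v
    have hF : neShadow C (diagram ρ) = neShadow C (diagram π) := by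
      rw [← neShadow_outer, h, neShadow_outer]
    by_cases hv : (π.symm v, v) ∈ neShadow C (diagram π)
    · rw [mem_columns_of_mem hv]
      have h1 : (ρ.symm v, v) ∈ neShadow C (diagram π) := by
        by_contra hn
        have : (ρ.symm v, v) ∈ outer C π := by
          rw [← h, outer, hF]
          exact ⟨mem_diagram_iff.2 rfl, hn⟩
        exact hn (by rwa [mem_diagram_iff.1 this.1])
      refine ⟨h1, ?_⟩
      by_contra hn
      have : (ρ.symm v, π (ρ.symm v)) ∈ outer C ρ := by
        rw [h]
        exact ⟨rfl, hn⟩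
      have h2 : ρ (ρ.symm v) = π (ρ.symm v) := this.1
      rw [Equiv.apply_symm_apply] at h2
      exact hn (by rwa [← h2])
    · rw [columns_of_notMem hv, mem_singleton]
      have : (π.symm v, v) ∈ outer C ρ := by
        rw [h]
        exact ⟨mem_diagram_iff.2 rfl, hv⟩
      exact (mem_diagram_iff.1 this.1).symm
  · intro h
    have hO : diagram ρ \ neShadow C (diagram π) = outer C π := by
      ext ⟨c, v⟩
      simp only [outer, Set.mem_sdiff, mem_diagram_iff, and_congr_left_iff]
      intro hcv
      by_cases hv : (π.symm v, v) ∈ neShadow C (diagram π)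
      · have := h v
        rw [mem_columns_of_mem hv] at this
        constructor
        · rintro rfl; exact absurd this.1 hcv
        · rintro rfl; exact absurd hv hcv
      · have := h v
        rw [columns_of_notMem hv, mem_singleton] at this
        rw [this]
    have hF : neShadow C (diagram π) ⊆ neShadow C (diagram ρ) := by
      rw [← neShadow_outer, ← hO]
      exact neShadow_mono C Set.sdiff_subset
    have hF' : neShadow C (diagram ρ) ⊆ neShadow C (diagram π) := by
      rw [← neShadow_outer, outer, ← neShadow_outer C π, ← hO]
      exact neShadow_mono C (Set.sdiff_subset_sdiff_right hF)
    rw [← hO, outer, hF'.antisymm hF]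

/-- The word of the columns of the entries of `ρ`, from the largest entry to the smallest. -/
def columnWord (ρ : Equiv.Perm (Fin n)) (v : Fin n) : Fin n := ρ.symm v.rev

lemma mem_avail_columnWord {ρ : Equiv.Perm (Fin n)} {S : Fin n → Finset (Fin n)} {v c : Fin n} :
    c ∈ avail S (columnWord ρ) v ↔ c ∈ S v ∧ ρ c ≤ v.rev := by
  simp only [avail, columnWord, mem_sdiff, mem_image, mem_filter, mem_univ, true_and,
    and_congr_right_iff, Equiv.symm_apply_eq]
  intro _
  rw [← not_lt, not_iff_not]
  constructor
  · rintro ⟨w, hw, h⟩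
    rw [← h]
    exact Fin.rev_lt_rev.2 hw
  · intro h
    exact ⟨(ρ c).rev, by rwa [← Fin.rev_lt_rev, Fin.rev_rev], Fin.rev_rev _⟩

lemma exists_columnWord_eq {Q : Finset (Fin n) → Fin n → Prop} {S : Fin n → Finset (Fin n)}
    {f : Fin n → Fin n} (hf : IsChoice Q S f) : ∃ ρ, columnWord ρ = f := by
  have hne : ∀ v w, w < v → f w ≠ f v := by
    intro v w hwv h
    have := (mem_sdiff.1 (hf v).1).2
    exact this (mem_image.2 ⟨w, by simpa using hwv, h⟩)
  have hinj : Function.Injective f := fun v w h => by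
    rcases lt_trichotomy v w with hvw | hvw | hvw
    · exact absurd h (hne _ _ hvw)
    · exact hvw
    · exact absurd h.symm (hne _ _ hvw)
  refine ⟨(Fin.revPerm.trans (Equiv.ofBijective f (Finite.injective_iff_bijective.1 hinj))).symm, ?_⟩
  ext v
  simp [columnWord]

open Classical in
lemma card_fiber_eq {Q : Finset (Fin n) → Fin n → Prop} {P : Equiv.Perm (Fin n) → Prop}
    {S : Fin n → Finset (Fin n)} (hP : ∀ ρ, P ρ ↔ IsChoice Q S (columnWord ρ)) :
    #{ρ | P ρ} = #{f | IsChoice Q S f} := by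
  refine card_bij (fun ρ _ => columnWord ρ) ?_ ?_ ?_
  · intro ρ hρ
    simpa [hP] using hρ
  · intro ρ _ τ _ h
    apply Equiv.symm_bijective.injective
    ext v
    simpa [columnWord] using congrArg Fin.val (congrFun h v.rev)
  · intro f hf
    obtain ⟨ρ, rfl⟩ := exists_columnWord_eq (mem_filter.1 hf).2
    exact ⟨ρ, by simpa [hP] using hf, rfl⟩

/-- The columns of the points weakly below height `v` that lie in the row `v` of the shadow. -/
noncomputable def lowerColumns (C : Set (Set (Fin n × Fin n))) (π : Equiv.Perm (Fin n))
    (v : Fin n) : Finset (Fin n) :=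
  open Classical in univ.filter fun k => (k, v) ∈ neShadow C (diagram π) ∧ π k ≤ v

lemma mem_lowerColumns {C : Set (Set (Fin n × Fin n))} {π : Equiv.Perm (Fin n)} {v k : Fin n} :
    k ∈ lowerColumns C π v ↔ (k, v) ∈ neShadow C (diagram π) ∧ π k ≤ v := by
  simp [lowerColumns]

/-- Every point in the shadow satisfies `Q` with respect to the points below it in the shadow. -/
def RowCondition (C : Set (Set (Fin n × Fin n))) (Q : Finset (Fin n) → Fin n → Prop)
    (π : Equiv.Perm (Fin n)) : Prop :=
  ∀ i, (i, π i) ∈ neShadow C (diagram π) → Q (lowerColumns C π (π i)) i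

lemma outer_eq_and_rowCondition_iff {C : Set (Set (Fin n × Fin n))}
    {Q : Finset (Fin n) → Fin n → Prop} (hQ : ∀ x, Q {x} x) {π ρ : Equiv.Perm (Fin n)} :
    outer C ρ = outer C π ∧ RowCondition C Q ρ ↔
      IsChoice Q (fun v => columns C π v.rev) (columnWord ρ) := by
  have h1 : outer C ρ = outer C π ↔ ∀ v, columnWord ρ v ∈
      avail (fun v => columns C π v.rev) (columnWord ρ) v := by
    rw [outer_eq_iff, ← Fin.revPerm.forall_congr_right]
    refine forall_congr' fun v => ?_
    rw [mem_avail_columnWord]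
    simp [columnWord]
  unfold IsChoice
  rw [forall_and, h1, and_congr_right_iff, ← h1]
  intro hO
  have hF : neShadow C (diagram ρ) = neShadow C (diagram π) := by
    rw [← neShadow_outer, hO, neShadow_outer]
  have hcol := outer_eq_iff.1 hO
  unfold RowCondition
  rw [← (Fin.revPerm.trans ρ.symm).forall_congr_right]
  refine forall_congr' fun v => ?_
  have hmem := @mem_avail_columnWord n ρ (fun v => columns C π v.rev) v
  simp only [Equiv.trans_apply, Fin.revPerm_apply, Equiv.apply_symm_apply]
  change _ → Q _ (columnWord ρ v) ↔ Q _ (columnWord ρ v)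
  by_cases hv : (π.symm v.rev, v.rev) ∈ neShadow C (diagram π)
  · have h2 : (ρ.symm v.rev, v.rev) ∈ neShadow C (diagram ρ) := by
      rw [hF]
      exact ((mem_columns_of_mem hv).1 (hcol _)).1
    have h3 : lowerColumns C ρ v.rev =
        avail (fun v => columns C π v.rev) (columnWord ρ) v := by
      ext k
      rw [hmem, mem_columns_of_mem hv, mem_lowerColumns, hF]
      refine ⟨fun h => ⟨⟨h.1, ?_⟩, h.2⟩, fun h => ⟨h.1.1, h.2⟩⟩
      have h4 : (k, ρ k) ∈ neShadow C (diagram ρ) := by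
        rw [hF]; exact neShadow_of_le h.1 ⟨le_rfl, h.2⟩
      by_contra hn
      have h5 : (k, π k) ∈ outer C ρ := by rw [hO]; exact ⟨rfl, hn⟩
      have h6 : ρ k = π k := h5.1
      exact h5.2 (by rwa [← h6])
    rw [h3]
    exact ⟨fun h => h h2, fun h _ => h⟩
  · have h2 : ρ.symm v.rev = π.symm v.rev := by
      have := hcol v.rev
      rwa [columns_of_notMem hv, mem_singleton] at this
    have h3 : avail (fun v => columns C π v.rev) (columnWord ρ) v = {columnWord ρ v} := by
      ext k
      rw [hmem, columns_of_notMem hv, mem_singleton, mem_singleton, ← h2]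
      exact ⟨fun h => h.1, fun h => ⟨h, by rw [h]; simp [columnWord]⟩⟩
    rw [h3, hF, h2]
    exact ⟨fun _ => hQ _, fun _ h => absurd h hv⟩

open Classical in
/-- The number of permutations satisfying a row condition only depends on the number of
admissible choices in a set of each size. -/
theorem card_rowCondition_eq {Q Q' : Finset (Fin n) → Fin n → Prop} {g : ℕ → ℕ}
    (hQ : ∀ S, #{x ∈ S | Q S x} = g #S) (hQ' : ∀ S, #{x ∈ S | Q' S x} = g #S)
    (h1 : ∀ x, Q {x} x) (h1' : ∀ x, Q' {x} x) (C : Set (Set (Fin n × Fin n))) :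
    #{π | RowCondition C Q π} = #{π | RowCondition C Q' π} := by
  rw [card_eq_sum_card_fiberwise (f := outer C) (t := univ) (by simp),
    card_eq_sum_card_fiberwise (f := outer C) (t := univ) (by simp)]
  refine sum_congr rfl fun O _ => ?_
  by_cases hO : ∃ π, outer C π = O
  · obtain ⟨π, rfl⟩ := hO
    simp only [filter_filter]
    have e := card_fiber_eq fun ρ => and_comm.trans (outer_eq_and_rowCondition_iff (C := C) h1 (π := π))
    have e' := card_fiber_eq fun ρ => and_comm.trans (outer_eq_and_rowCondition_iff (C := C) h1' (π := π))
    convert e.trans (Eq.trans ?_ e'.symm)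
    refine card_isChoice_eq hQ hQ' _ _ (fun _ => rfl) fun v w hvw => ?_
    simpa using columns_laminar C π (Fin.rev_lt_rev.2 hvw)
  · push Not at hO
    simp [hO]

open Classical in
/-- In the shadow, bounding the number of south-west points is equinumerous to bounding the
number of south-east points in the shadow's row. -/
theorem card_southWest_eq_card_southEast {m : ℕ} (hm : 0 < m) (C : Set (Set (Fin n × Fin n))) :
    Nat.card {π : Equiv.Perm (Fin n) // ∀ i, (i, π i) ∈ neShadow C (diagram π) →
      #{k | k < i ∧ π k < π i} < m} =
    Nat.card {π : Equiv.Perm (Fin n) // ∀ i, (i, π i) ∈ neShadow C (diagram π) →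
      #{k | i < k ∧ π k < π i ∧ (k, π i) ∈ neShadow C (diagram π)} < m} := by
  simp only [Nat.card_eq_fintype_card, Fintype.card_subtype]
  have h := card_rowCondition_eq (n := n) (Q := fun S x => #{k ∈ S | k < x} < m)
    (Q' := fun S x => #{k ∈ S | x < k} < m) (g := min m)
    (fun S => by convert card_rank_lt m S) (fun S => by convert card_corank_lt m S)
    (fun _ => by simpa [filter_singleton] using hm)
    (fun _ => by simpa [filter_singleton] using hm) C
  convert h using 2
  · refine filter_congr fun π _ => forall_congr' fun i => imp_congr_right fun hi => ?_
    have : ({k | k < i ∧ π k < π i} : Finset (Fin n)) =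
        {k ∈ lowerColumns C π (π i) | k < i} := by
      ext k
      simp only [mem_lowerColumns, mem_filter, mem_univ, true_and]
      refine ⟨fun hk => ⟨⟨neShadow_of_le hi ⟨hk.1.le, le_rfl⟩, hk.2.le⟩, hk.1⟩, fun hk => ⟨hk.2, ?_⟩⟩
      exact hk.1.2.lt_of_ne (π.injective.ne hk.2.ne)
    rw [this]
  · refine filter_congr fun π _ => forall_congr' fun i => imp_congr_right fun hi => ?_
    have : ({k | i < k ∧ π k < π i ∧ (k, π i) ∈ neShadow C (diagram π)} : Finset (Fin n)) =
        {k ∈ lowerColumns C π (π i) | i < k} := by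
      ext k
      simp only [mem_lowerColumns, mem_filter, mem_univ, true_and]
      refine ⟨fun hk => ⟨⟨hk.2.2, hk.2.1.le⟩, hk.1⟩, fun hk => ⟨hk.2, ?_, hk.1.1⟩⟩
      exact hk.1.2.lt_of_ne (π.injective.ne hk.2.ne')
    rw [this]

end Shadow

section Patterns

variable {n : ℕ}

lemma permContains_mkPattern {k : ℕ} {v : Fin k → Fin k} (hv : Function.Bijective v)
    {π : Equiv.Perm (Fin n)} :
    PermContains π (mkPattern v hv) ↔
      ∃ f : Fin k → Fin n, StrictMono f ∧ ∀ a b, π (f a) < π (f b) ↔ v a < v b :=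
  Iff.rfl

lemma permContains_mkPattern_five {v : Fin 5 → Fin 5} (hv : Function.Bijective v)
    (u : Fin 5 → Fin 5) (huv : ∀ i, u (v i) = i) (hvu : ∀ i, v (u i) = i)
    {π : Equiv.Perm (Fin n)} :
    PermContains π (mkPattern v hv) ↔ ∃ a b c d e, a < b ∧ b < c ∧ c < d ∧ d < e ∧
      ∀ k : Fin 4, π (![a, b, c, d, e] (u k.castSucc)) < π (![a, b, c, d, e] (u k.succ)) := by
  rw [permContains_mkPattern]
  constructor
  · rintro ⟨f, hf, h⟩
    refine ⟨f 0, f 1, f 2, f 3, f 4, hf (by decide), hf (by decide), hf (by decide),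
      hf (by decide), fun k => ?_⟩
    have hfe : ![f 0, f 1, f 2, f 3, f 4] = f := by
      ext i; fin_cases i <;> rfl
    rw [hfe]
    refine (h _ _).2 ?_
    rw [hvu, hvu]
    exact Fin.castSucc_lt_succ
  · rintro ⟨a, b, c, d, e, hab, hbc, hcd, hde, h⟩
    have hmono : StrictMono fun k => π (![a, b, c, d, e] (u k)) := Fin.strictMono_iff_lt_succ.2 h
    refine ⟨![a, b, c, d, e], ?_, fun i j => ?_⟩
    · refine Fin.strictMono_iff_lt_succ.2 fun i => ?_
      fin_cases i <;> assumption
    · simpa only [huv] using hmono.lt_iff_lt (a := v i) (b := v j)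

lemma avoidsSet_pair {π : Equiv.Perm (Fin n)} {p q : Pattern} :
    AvoidsSet π {p, q} ↔ ¬ (PermContains π p ∨ PermContains π q) := by
  simp [AvoidsSet]

lemma avoids_12345_21345_iff {π : Equiv.Perm (Fin n)} :
    AvoidsSet π {mkPattern ![0,1,2,3,4], mkPattern ![1,0,2,3,4]} ↔
      ∀ a b c d e, a < b → b < c → c < d → d < e →
        ¬ (π a < π c ∧ π b < π c ∧ π c < π d ∧ π d < π e) := by
  rw [avoidsSet_pair, permContains_mkPattern_five _ ![0,1,2,3,4] (by decide) (by decide),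
    permContains_mkPattern_five _ ![1,0,2,3,4] (by decide) (by decide)]
  simp [Fin.forall_fin_succ, -not_or, -not_exists, -not_and, -exists_and_left]
  constructor
  · rintro H a b c d e hab hbc hcd hde ⟨hac, h1, h2, h3⟩
    rcases lt_or_gt_of_ne (π.injective.ne hab.ne) with h | h
    · exact H (.inl ⟨a, b, c, d, e, hab, hbc, hcd, hde, h, h1, h2, h3⟩)
    · exact H (.inr ⟨a, b, c, d, e, hab, hbc, hcd, hde, h, hac, h2, h3⟩)
  · rintro H (⟨a, b, c, d, e, hab, hbc, hcd, hde, h, h1, h2, h3⟩ |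
      ⟨a, b, c, d, e, hab, hbc, hcd, hde, h, h1, h2, h3⟩)
    · exact H a b c d e hab hbc hcd hde ⟨h.trans h1, h1, h2, h3⟩
    · exact H a b c d e hab hbc hcd hde ⟨h1, h.trans h1, h2, h3⟩

lemma avoids_31254_32154_iff {π : Equiv.Perm (Fin n)} :
    AvoidsSet π {mkPattern ![2,0,1,4,3], mkPattern ![2,1,0,4,3]} ↔
      ∀ a b c d e, a < b → b < c → c < d → d < e →
        ¬ (π b < π a ∧ π c < π a ∧ π a < π e ∧ π e < π d) := by
  rw [avoidsSet_pair, permContains_mkPattern_five _ ![1,2,0,4,3] (by decide) (by decide),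
    permContains_mkPattern_five _ ![2,1,0,4,3] (by decide) (by decide)]
  simp [Fin.forall_fin_succ, -not_or, -not_exists, -not_and, -exists_and_left]
  constructor
  · rintro H a b c d e hab hbc hcd hde ⟨hba, h1, h2, h3⟩
    rcases lt_or_gt_of_ne (π.injective.ne hbc.ne) with h | h
    · exact H (.inl ⟨a, b, c, d, e, hab, hbc, hcd, hde, h, h1, h2, h3⟩)
    · exact H (.inr ⟨a, b, c, d, e, hab, hbc, hcd, hde, h, hba, h2, h3⟩)
  · rintro H (⟨a, b, c, d, e, hab, hbc, hcd, hde, h, h1, h2, h3⟩ |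
      ⟨a, b, c, d, e, hab, hbc, hcd, hde, h, h1, h2, h3⟩)
    · exact H a b c d e hab hbc hcd hde ⟨h.trans h1, h1, h2, h3⟩
    · exact H a b c d e hab hbc hcd hde ⟨h1, h.trans h1, h2, h3⟩

/-- The occurrences of `123` and `132` in the grid. -/
def minFirstTriples (n : ℕ) : Set (Set (Fin n × Fin n)) :=
  {t | ∃ a b c : Fin n × Fin n, t = {a, b, c} ∧ a.1 < b.1 ∧ b.1 < c.1 ∧ a.2 < b.2 ∧ a.2 < c.2}

/-- The occurrences of `21` in the grid. -/
def descents (n : ℕ) : Set (Set (Fin n × Fin n)) :=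
  {t | ∃ a b : Fin n × Fin n, t = {a, b} ∧ a.1 < b.1 ∧ b.2 < a.2}

lemma mem_neShadow_minFirstTriples {π : Equiv.Perm (Fin n)} {i v : Fin n} :
    (i, v) ∈ neShadow (minFirstTriples n) (diagram π) ↔
      ∃ a b c, i < a ∧ a < b ∧ b < c ∧ v < π a ∧ π a < π b ∧ π a < π c := by
  constructor
  · rintro ⟨_, ⟨⟨a, x⟩, ⟨b, y⟩, ⟨c, z⟩, rfl, h⟩, hR, hp⟩
    simp only [Set.insert_subset_iff, Set.singleton_subset_iff, diagram, Set.mem_ofPred_eq] at hR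
    obtain ⟨rfl, rfl, rfl⟩ := hR
    simp only [Set.mem_insert_iff, Set.mem_singleton_iff, forall_eq_or_imp, forall_eq] at hp
    exact ⟨a, b, c, by grind⟩
  · rintro ⟨a, b, c, h⟩
    refine ⟨{(a, π a), (b, π b), (c, π c)}, ⟨_, _, _, rfl, by grind⟩, ?_, ?_⟩
    · simp [Set.insert_subset_iff, diagram]
    · simp only [Set.mem_insert_iff, Set.mem_singleton_iff, forall_eq_or_imp, forall_eq]
      grind

lemma mem_neShadow_descents {π : Equiv.Perm (Fin n)} {i v : Fin n} :
    (i, v) ∈ neShadow (descents n) (diagram π) ↔ ∃ a b, i < a ∧ a < b ∧ v < π b ∧ π b < π a := by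
  constructor
  · rintro ⟨_, ⟨⟨a, x⟩, ⟨b, y⟩, rfl, h⟩, hR, hp⟩
    simp only [Set.insert_subset_iff, Set.singleton_subset_iff, diagram, Set.mem_ofPred_eq] at hR
    obtain ⟨rfl, rfl⟩ := hR
    simp only [Set.mem_insert_iff, Set.mem_singleton_iff, forall_eq_or_imp, forall_eq] at hp
    exact ⟨a, b, by grind⟩
  · rintro ⟨a, b, h⟩
    refine ⟨{(a, π a), (b, π b)}, ⟨_, _, rfl, by grind⟩, ?_, ?_⟩
    · simp [Set.insert_subset_iff, diagram]
    · simp only [Set.mem_insert_iff, Set.mem_singleton_iff, forall_eq_or_imp, forall_eq]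
      grind

/-- Reverse-complement of permutations. -/
def reverseComplement (n : ℕ) : Equiv.Perm (Fin n) ≃ Equiv.Perm (Fin n) :=
  Equiv.equivCongr Fin.revPerm Fin.revPerm

lemma reverseComplement_apply (π : Equiv.Perm (Fin n)) (i : Fin n) :
    reverseComplement n π i = (π i.rev).rev := rfl

lemma card_lt_two_iff {α : Type*} [LinearOrder α] {s : Finset α} :
    #s < 2 ↔ ∀ k ∈ s, ∀ l ∈ s, ¬ k < l := by
  rw [Nat.lt_succ_iff, card_le_one]
  exact ⟨fun h k hk l hl hkl => hkl.ne (h k hk l hl), fun h k hk l hl =>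
    le_antisymm (not_lt.1 (h l hl k hk)) (not_lt.1 (h k hk l hl))⟩

lemma card_minFirst :
    Nat.card {π : Equiv.Perm (Fin n) // ∀ k i a b c, k < i → i < a → a < b → b < c →
      ¬ (π k < π i ∧ π i < π a ∧ π a < π b ∧ π a < π c)} =
    Nat.card {π : Equiv.Perm (Fin n) // ∀ i k a b c, i < k → k < a → a < b → b < c →
      ¬ (π k < π i ∧ π i < π a ∧ π a < π b ∧ π a < π c)} := by
  refine (Nat.card_congr (Equiv.subtypeEquivRight fun π => ?_)).trans
    ((card_southWest_eq_card_southEast one_pos (minFirstTriples n)).trans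
      (Nat.card_congr (Equiv.subtypeEquivRight fun π => ?_))) <;>
    simp only [mem_neShadow_minFirstTriples, Nat.lt_one_iff, card_eq_zero, filter_eq_empty_iff,
      mem_univ, true_imp_iff]
  · exact ⟨fun h i ⟨a, b, c, ha, hb, hc, h'⟩ k ⟨hk, hk'⟩ => h k i a b c hk ha hb hc ⟨hk', h'⟩,
      fun h k i a b c hk ha hb hc ⟨hk', h'⟩ => h i ⟨a, b, c, ha, hb, hc, h'⟩ ⟨hk, hk'⟩⟩
  · refine ⟨fun h i k a b c hk ha hb hc ⟨hk', h'⟩ => ?_, fun h i _ k ⟨hk, hk', h'⟩ => ?_⟩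
    · exact h i ⟨a, b, c, hk.trans ha, hb, hc, h'⟩ ⟨hk, hk', a, b, c, ha, hb, hc, h'⟩
    · obtain ⟨a, b, c, ha, hb, hc, h'⟩ := h'
      exact h i k a b c hk ha hb hc ⟨hk', h'⟩

lemma card_descents :
    Nat.card {π : Equiv.Perm (Fin n) // ∀ k l i a b, k < l → l < i → i < a → a < b →
      ¬ (π k < π i ∧ π l < π i ∧ π i < π b ∧ π b < π a)} =
    Nat.card {π : Equiv.Perm (Fin n) // ∀ i k l a b, i < k → k < l → l < a → a < b →
      ¬ (π k < π i ∧ π l < π i ∧ π i < π b ∧ π b < π a)} := by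
  refine (Nat.card_congr (Equiv.subtypeEquivRight fun π => ?_)).trans
    ((card_southWest_eq_card_southEast two_pos (descents n)).trans
      (Nat.card_congr (Equiv.subtypeEquivRight fun π => ?_))) <;>
    simp only [mem_neShadow_descents, card_lt_two_iff, mem_filter, mem_univ, true_and]
  · refine ⟨fun h i ⟨a, b, ha, hb, h'⟩ k ⟨_, hk⟩ l ⟨hl, hl'⟩ hkl => ?_,
      fun h k l i a b hkl hl ha hb ⟨hk', hl', h'⟩ => ?_⟩
    · exact h k l i a b hkl hl ha hb ⟨hk, hl', h'⟩
    · exact h i ⟨a, b, ha, hb, h'⟩ k ⟨hkl.trans hl, hk'⟩ l ⟨hl, hl'⟩ hkl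
  · refine ⟨fun h i k l a b hk hkl ha hb ⟨hk', hl', h'⟩ => ?_,
      fun h i _ k ⟨hk, hk', _⟩ l ⟨_, hl', h'⟩ hkl => ?_⟩
    · exact h i ⟨a, b, hk.trans (hkl.trans ha), hb, h'⟩ k ⟨hk, hk', a, b, hkl.trans ha, hb, h'⟩
        l ⟨hk.trans hkl, hl', a, b, ha, hb, h'⟩ hkl
    · obtain ⟨a, b, ha, hb, h'⟩ := h'
      exact h i k l a b hk hkl ha hb ⟨hk', hl', h'⟩

end Patterns

/-- The pattern sets {12345, 21345} and {31254, 32154} are Wilf-equivalent. -/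
theorem stmt1 : WilfEquiv {mkPattern ![0,1,2,3,4], mkPattern ![1,0,2,3,4]} {mkPattern ![2,0,1,4,3], mkPattern ![2,1,0,4,3]} := by
  intro n _
  simp only [avoids_12345_21345_iff, avoids_31254_32154_iff]
  have h1 := Nat.card_congr ((reverseComplement n).subtypeEquiv (p := fun π => ∀ k i a b c, k < i →
      i < a → a < b → b < c → ¬ (π k < π i ∧ π i < π a ∧ π a < π b ∧ π a < π c))
    (q := fun π => ∀ a b c d e, a < b → b < c → c < d → d < e →
        ¬ (π a < π c ∧ π b < π c ∧ π c < π d ∧ π d < π e)) fun π => by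
    simp only [reverseComplement_apply, Fin.rev_lt_rev]
    refine ⟨fun h a b c d e hab hbc hcd hde ⟨h1, h2, h3, h4⟩ =>
      h e.rev d.rev c.rev b.rev a.rev (Fin.rev_lt_rev.2 hde) (Fin.rev_lt_rev.2 hcd)
        (Fin.rev_lt_rev.2 hbc) (Fin.rev_lt_rev.2 hab) ⟨h4, h3, h2, h1⟩,
      fun h a b c d e hab hbc hcd hde ⟨h1, h2, h3, h4⟩ =>
      h e.rev d.rev c.rev b.rev a.rev (Fin.rev_lt_rev.2 hde) (Fin.rev_lt_rev.2 hcd)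
        (Fin.rev_lt_rev.2 hbc) (Fin.rev_lt_rev.2 hab) ?_⟩
    simpa only [Fin.rev_rev] using (And.intro h4 ⟨h3, h2, h1⟩))
  have h2 := Nat.card_congr ((reverseComplement n).subtypeEquiv (p := fun π => ∀ i k a b c, i < k →
      k < a → a < b → b < c → ¬ (π k < π i ∧ π i < π a ∧ π a < π b ∧ π a < π c))
    (q := fun π => ∀ k l i a b, k < l → l < i → i < a → a < b →
      ¬ (π k < π i ∧ π l < π i ∧ π i < π b ∧ π b < π a)) fun π => by
    simp only [reverseComplement_apply, Fin.rev_lt_rev]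
    refine ⟨fun h a b c d e hab hbc hcd hde ⟨h1, h2, h3, h4⟩ =>
      h e.rev d.rev c.rev b.rev a.rev (Fin.rev_lt_rev.2 hde) (Fin.rev_lt_rev.2 hcd)
        (Fin.rev_lt_rev.2 hbc) (Fin.rev_lt_rev.2 hab) ⟨h4, h3, h2, h1⟩,
      fun h a b c d e hab hbc hcd hde ⟨h1, h2, h3, h4⟩ =>
      h e.rev d.rev c.rev b.rev a.rev (Fin.rev_lt_rev.2 hde) (Fin.rev_lt_rev.2 hcd)
        (Fin.rev_lt_rev.2 hbc) (Fin.rev_lt_rev.2 hab) ?_⟩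
    simpa only [Fin.rev_rev] using (And.intro h4 ⟨h3, h2, h1⟩))
  rw [← h1]
  exact card_minFirst.trans (h2.trans card_descents)
end

section
/- For every k ≥ 1 and all t1, t2 ∈ {1,…,k}, the pattern sets A_{k,t1} and A_{k,t2} are shape-Wilf-equivalent. (This states that any two partially ordered patterns of length k whose poset has one element above all the others, which are mutually incomparable, are shape-Wilf-equivalent, regardless of the label of the top element.) -/
/-- A Ferrers board on `[n] × [n]`: a downward-closed set of cells `(column, row)`
(0-indexed). -/
structure FerrersBoard (n : ℕ) where
  cells : Set (Fin n × Fin n)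
  downward_closed : ∀ ⦃i j i' j' : Fin n⦄, (i, j) ∈ cells → i' ≤ i → j' ≤ j → (i', j') ∈ cells

/-- `σ` is a filling of the Ferrers board `F`: each rook `(i, σ i)` lies on the board. -/
def IsFilling {n : ℕ} (F : FerrersBoard n) (σ : Equiv.Perm (Fin n)) : Prop :=
  ∀ i : Fin n, (i, σ i) ∈ F.cells

/-- The filling `σ` of `F` contains an occurrence of the pattern `p`: there are
columns `f 0 < f 1 < ⋯` whose rooks are order-isomorphic to `p`, and the whole
rectangle spanned by the occurrence lies in `F` (equivalently, by downward closure,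
the top-right corner cell lies in `F`). -/
def FillingContains {n : ℕ} (F : FerrersBoard n) (σ : Equiv.Perm (Fin n)) (p : Pattern) : Prop :=
  ∃ f : Fin p.1 → Fin n, StrictMono f ∧
    (∀ a b : Fin p.1, σ (f a) < σ (f b) ↔ p.2 a < p.2 b) ∧
    (∀ a b : Fin p.1, (f a, σ (f b)) ∈ F.cells)

/-- The filling `σ` of `F` avoids every pattern in the set `S`. -/
def FillingAvoidsSet {n : ℕ} (F : FerrersBoard n) (σ : Equiv.Perm (Fin n)) (S : Set Pattern) : Prop :=
  ∀ p ∈ S, ¬ FillingContains F σ p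

/-- Two sets of patterns are shape-Wilf-equivalent: for every `n ≥ 1` and every
Ferrers board `F` on `[n] × [n]`, the number of fillings of `F` avoiding every
pattern of `S1` equals the number of fillings of `F` avoiding every pattern of `S2`. -/
def ShapeWilfEquiv (S1 S2 : Set Pattern) : Prop :=
  ∀ n : ℕ, 1 ≤ n → ∀ F : FerrersBoard n,
    Nat.card {σ : Equiv.Perm (Fin n) // IsFilling F σ ∧ FillingAvoidsSet F σ S1} =
    Nat.card {σ : Equiv.Perm (Fin n) // IsFilling F σ ∧ FillingAvoidsSet F σ S2}

/-- `Aset k t` is the set of all patterns of length `k` whose maximum value occurs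
at position `t` (avoiding all of them is avoiding the POP with element `t` above
all other, mutually incomparable, elements). -/
def Aset (k : ℕ) (t : Fin k) : Set Pattern :=
  {r | ∃ σ : Equiv.Perm (Fin k), (∀ a : Fin k, σ a ≤ σ t) ∧ r = ⟨k, σ⟩}

/-- In a sequence satisfying this predicate, each entry is one of the candidates `S T`
determined by the set `T` of the preceding entries. -/
def IsSequentialChoice {α : Type*} [DecidableEq α] (S : Finset α → Finset α) {m : ℕ}
    (f : Fin m → α) : Prop :=
  ∀ i, f i ∈ S ((Finset.Iio i).image f)

section SequentialChoice

variable {α : Type*} [DecidableEq α] {S : Finset α → Finset α}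

theorem image_Iio_castSucc {m : ℕ} (f : Fin (m + 1) → α) (i : Fin m) :
    (Finset.Iio i.castSucc).image f = (Finset.Iio i).image (fun j => f j.castSucc) := by
  ext x
  simp only [Finset.mem_image, Finset.mem_Iio]
  constructor
  · rintro ⟨j, hj, rfl⟩
    exact ⟨⟨j, lt_trans hj i.2⟩, hj, rfl⟩
  · rintro ⟨j, hj, rfl⟩
    exact ⟨j.castSucc, hj, rfl⟩

theorem image_Iio_last {m : ℕ} (f : Fin (m + 1) → α) :
    (Finset.Iio (Fin.last m)).image f = Finset.univ.image (fun j : Fin m => f j.castSucc) := by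
  ext x
  simp only [Finset.mem_image, Finset.mem_Iio, Finset.mem_univ, true_and]
  constructor
  · rintro ⟨j, hj, rfl⟩
    exact ⟨⟨j, hj⟩, rfl⟩
  · rintro ⟨j, rfl⟩
    exact ⟨j.castSucc, j.castSucc_lt_last, rfl⟩

theorem isSequentialChoice_succ_iff {m : ℕ} (f : Fin (m + 1) → α) :
    IsSequentialChoice S f ↔ IsSequentialChoice S (fun j : Fin m => f j.castSucc) ∧
      f (Fin.last m) ∈ S (Finset.univ.image (fun j : Fin m => f j.castSucc)) := by
  simp only [IsSequentialChoice, Fin.forall_fin_succ', image_Iio_castSucc, image_Iio_last]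

/-- A sequential choice of length `m + 1` is one of length `m` together with a last entry. -/
def sequentialChoiceSuccEquiv (S : Finset α → Finset α) (m : ℕ) :
    {f : Fin (m + 1) → α // IsSequentialChoice S f} ≃
      Σ g : {g : Fin m → α // IsSequentialChoice S g}, {x // x ∈ S (Finset.univ.image g.1)} where
  toFun f := ⟨⟨fun j => f.1 j.castSucc, ((isSequentialChoice_succ_iff _).1 f.2).1⟩,
    ⟨f.1 (Fin.last m), ((isSequentialChoice_succ_iff _).1 f.2).2⟩⟩
  invFun p := ⟨Fin.snoc (α := fun _ => α) p.1.1 p.2.1, (isSequentialChoice_succ_iff _).2 (by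
    simp only [Fin.snoc_castSucc, Fin.snoc_last]
    exact ⟨p.1.2, p.2.2⟩)⟩
  left_inv f := by
    ext i
    refine Fin.lastCases ?_ (fun j => ?_) i <;> simp
  right_inv p := by
    rcases p with ⟨⟨g, hg⟩, ⟨x, hx⟩⟩
    have h : (fun j : Fin m => Fin.snoc (α := fun _ => α) g x j.castSucc) = g := by
      ext j
      simp
    refine Sigma.subtype_ext (Subtype.ext h) ?_
    simp

theorem IsSequentialChoice.injective (hS : ∀ T, ∀ x ∈ S T, x ∉ T) {m : ℕ} {f : Fin m → α}
    (hf : IsSequentialChoice S f) : Function.Injective f := by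
  have key : ∀ i j, i < j → f i ≠ f j := fun i j hij h =>
    hS _ _ (hf j) (Finset.mem_image.2 ⟨i, Finset.mem_Iio.2 hij, h⟩)
  intro i j h
  rcases lt_trichotomy i j with hij | hij | hij
  · exact absurd h (key i j hij)
  · exact hij
  · exact absurd h.symm (key j i hij)

theorem IsSequentialChoice.invariant {I : Finset α → Prop} (h0 : I ∅)
    (hI : ∀ T, I T → ∀ x ∈ S T, I (insert x T)) {m : ℕ} {f : Fin m → α}
    (hf : IsSequentialChoice S f) : I (Finset.univ.image f) := by
  induction m with
  | zero => simpa using h0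
  | succ m ih =>
    rw [isSequentialChoice_succ_iff] at hf
    have h := hI _ (ih hf.1) _ hf.2
    convert h using 1
    ext x
    simp [Fin.exists_fin_succ', or_comm, eq_comm]

theorem card_sequentialChoice [Finite α] (hS : ∀ T, ∀ x ∈ S T, x ∉ T) {I : Finset α → Prop}
    (h0 : I ∅) (hI : ∀ T, I T → ∀ x ∈ S T, I (insert x T)) {c : ℕ → ℕ}
    (hc : ∀ T, I T → (S T).card = c T.card) (m : ℕ) :
    Nat.card {f : Fin m → α // IsSequentialChoice S f} = ∏ i ∈ Finset.range m, c i := by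
  induction m with
  | zero =>
    have : IsSequentialChoice S (Fin.elim0 : Fin 0 → α) := fun i => i.elim0
    rw [Finset.prod_range_zero, Nat.card_eq_one_iff_unique]
    exact ⟨⟨fun f g => Subtype.ext (Subsingleton.elim _ _)⟩, ⟨⟨_, this⟩⟩⟩
  | succ m ih =>
    have := Fintype.ofFinite α
    have := Fintype.ofFinite {g : Fin m → α // IsSequentialChoice S g}
    rw [Nat.card_congr (sequentialChoiceSuccEquiv S m), Nat.card_sigma, Finset.prod_range_succ,
      ← ih]
    have h : ∀ g : {g : Fin m → α // IsSequentialChoice S g},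
        Nat.card {x // x ∈ S (Finset.univ.image g.1)} = c m := by
      intro g
      have h := hc _ (g.2.invariant h0 hI)
      rw [Finset.card_image_of_injective _ (g.2.injective hS), Finset.card_fin] at h
      simpa using h
    simp_rw [h]
    simp

end SequentialChoice

section Rank

variable {α : Type*} [LinearOrder α]

theorem card_filter_lt_add_card_filter_gt (X : Finset α) {c : α} (hc : c ∈ X) :
    (X.filter (· < c)).card + (X.filter (c < ·)).card + 1 = X.card := by
  have h := Finset.card_filter_add_card_filter_not (s := X) (· < c)
  have h2 : X.filter (fun x => ¬ x < c) = insert c (X.filter (c < ·)) := by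
    ext x
    simp only [Finset.mem_filter, Finset.mem_insert, not_lt]
    grind
  rw [h2, Finset.card_insert_of_notMem (by simp)] at h
  omega

theorem card_filter_lt_injOn (X : Finset α) :
    Set.InjOn (fun c => (X.filter (· < c)).card) (X : Set α) := by
  have key : ∀ a ∈ X, ∀ b, a < b → (X.filter (· < a)).card < (X.filter (· < b)).card := by
    intro a ha b hab
    refine Finset.card_lt_card (Finset.ssubset_iff_subset_ne.2 ⟨fun x hx => ?_, fun h => ?_⟩)
    · rw [Finset.mem_filter] at hx ⊢
      exact ⟨hx.1, hx.2.trans hab⟩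
    · have : a ∈ X.filter (· < a) := h ▸ Finset.mem_filter.2 ⟨ha, hab⟩
      simp at this
  intro a ha b hb h
  rcases lt_trichotomy a b with hab | hab | hab
  · exact absurd h (key a ha b hab).ne
  · exact hab
  · exact absurd h (key b hb a hab).ne'

theorem image_card_filter_lt (X : Finset α) :
    X.image (fun c => (X.filter (· < c)).card) = Finset.range X.card := by
  refine Finset.eq_of_subset_of_card_le (fun a ha => ?_) ?_
  · obtain ⟨c, hc, rfl⟩ := Finset.mem_image.1 ha
    have := card_filter_lt_add_card_filter_gt X hc
    rw [Finset.mem_range]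
    omega
  · rw [Finset.card_image_of_injOn (card_filter_lt_injOn X), Finset.card_range]

theorem card_filter_not_le_rank (X : Finset α) (s t : ℕ) :
    (X.filter (fun c => ¬ (s ≤ (X.filter (· < c)).card ∧ t ≤ (X.filter (c < ·)).card))).card
      = min X.card (s + t) := by
  have h1 : X.filter (fun c => ¬ (s ≤ (X.filter (· < c)).card ∧ t ≤ (X.filter (c < ·)).card))
      = X.filter (fun c => (X.filter (· < c)).card ∉ Finset.Ico s (X.card - t)) := by
    refine Finset.filter_congr fun c hc => ?_
    have := card_filter_lt_add_card_filter_gt X hc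
    rw [Finset.mem_Ico]
    omega
  have h2 := Finset.card_image_of_injOn ((card_filter_lt_injOn X).mono
    (Finset.coe_subset.2 (Finset.filter_subset
      (fun c => (X.filter (· < c)).card ∉ Finset.Ico s (X.card - t)) X)))
  have h3 : (X.filter (fun c => (X.filter (· < c)).card ∉ Finset.Ico s (X.card - t))).image
      (fun c => (X.filter (· < c)).card) = Finset.range X.card \ Finset.Ico s (X.card - t) := by
    rw [← image_card_filter_lt]
    ext a
    simp only [Finset.mem_image, Finset.mem_filter, Finset.mem_sdiff]
    grind
  have h4 : Finset.Ico s (X.card - t) ⊆ Finset.range X.card := by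
    intro a
    simp only [Finset.mem_Ico, Finset.mem_range]
    omega
  rw [h1, ← h2, h3, Finset.card_sdiff_of_subset h4, Finset.card_range, Nat.card_Ico]
  omega

theorem exists_strictMono_apply_eq_iff (X : Finset α) {c : α} (hc : c ∈ X) {k : ℕ} (t : Fin k) :
    (∃ f : Fin k → α, StrictMono f ∧ (∀ a, f a ∈ X) ∧ f t = c) ↔
      (t : ℕ) ≤ (X.filter (· < c)).card ∧ k - 1 - t ≤ (X.filter (c < ·)).card := by
  constructor
  · rintro ⟨f, hf, hX, rfl⟩
    constructor
    · rw [← Fin.card_Iio t, ← Finset.card_image_of_injective _ hf.injective]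
      refine Finset.card_le_card fun x hx => ?_
      obtain ⟨a, ha, rfl⟩ := Finset.mem_image.1 hx
      exact Finset.mem_filter.2 ⟨hX a, hf (Finset.mem_Iio.1 ha)⟩
    · rw [← Fin.card_Ioi t, ← Finset.card_image_of_injective _ hf.injective]
      refine Finset.card_le_card fun x hx => ?_
      obtain ⟨a, ha, rfl⟩ := Finset.mem_image.1 hx
      exact Finset.mem_filter.2 ⟨hX a, hf (Finset.mem_Ioi.1 ha)⟩
  · rintro ⟨hl, hr⟩
    obtain ⟨L, hLX, hL⟩ := Finset.exists_subset_card_eq hl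
    obtain ⟨R, hRX, hR⟩ := Finset.exists_subset_card_eq hr
    have hL' : ∀ x ∈ L, x ∈ X ∧ x < c := fun x hx => Finset.mem_filter.1 (hLX hx)
    have hR' : ∀ x ∈ R, x ∈ X ∧ c < x := fun x hx => Finset.mem_filter.1 (hRX hx)
    obtain ⟨Y, hY⟩ : ∃ Y, Y = L ∪ insert c R := ⟨_, rfl⟩
    have hYL : Y.filter (· < c) = L := by
      ext x
      simp only [hY, Finset.mem_filter, Finset.mem_union, Finset.mem_insert]
      grind
    have hYR : Y.filter (c < ·) = R := by
      ext x
      simp only [hY, Finset.mem_filter, Finset.mem_union, Finset.mem_insert]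
      grind
    have hcY : c ∈ Y := by simp [hY]
    have hcard := card_filter_lt_add_card_filter_gt Y hcY
    rw [hYL, hYR, hL, hR] at hcard
    have hk : Y.card = k := by omega
    obtain ⟨j, hj⟩ : ∃ j, Y.orderEmbOfFin hk j = c := by
      have : c ∈ Set.range (Y.orderEmbOfFin hk) := by simpa using hcY
      exact this
    refine ⟨Y.orderEmbOfFin hk, (Y.orderEmbOfFin hk).strictMono, fun a => ?_, ?_⟩
    · have := Y.orderEmbOfFin_mem hk a
      simp only [hY, Finset.mem_union, Finset.mem_insert] at this
      grind
    · have hj' : (Finset.Iio j).image (Y.orderEmbOfFin hk) = L := by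
        rw [← hYL]
        ext x
        simp only [Finset.mem_image, Finset.mem_Iio, Finset.mem_filter]
        constructor
        · rintro ⟨a, ha, rfl⟩
          exact ⟨Y.orderEmbOfFin_mem hk a, hj ▸ (Y.orderEmbOfFin hk).strictMono ha⟩
        · rintro ⟨hx, hxc⟩
          obtain ⟨a, rfl⟩ : x ∈ Set.range (Y.orderEmbOfFin hk) := by simpa using hx
          rw [← hj, (Y.orderEmbOfFin hk).lt_iff_lt] at hxc
          exact ⟨a, hxc, rfl⟩
      have : (j : ℕ) = t := by
        rw [← hL, ← hj', Finset.card_image_of_injective _ (Y.orderEmbOfFin hk).injective,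
          Fin.card_Iio]
      rw [← hj, Fin.ext this]

/-- Every injective word is order-isomorphic to a permutation. -/
theorem exists_perm_lt_iff_lt {k : ℕ} {g : Fin k → α} (hg : Function.Injective g) :
    ∃ p : Equiv.Perm (Fin k), ∀ a b, g a < g b ↔ p a < p b := by
  have hmono : StrictMono (g ∘ Tuple.sort g) :=
    (Tuple.monotone_sort g).strictMono_of_injective (hg.comp (Tuple.sort g).injective)
  refine ⟨(Tuple.sort g).symm, fun a b => ?_⟩
  rw [← hmono.lt_iff_lt]
  simp

end Rank

section Ferrers

open Classical in
/-- The columns whose rook lies weakly below the row of the rook of `c`, and which meet that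
row inside the board. -/
noncomputable def columnsBelow {n : ℕ} (F : FerrersBoard n) (σ : Equiv.Perm (Fin n)) (c : Fin n) :
    Finset (Fin n) :=
  Finset.univ.filter fun d => (d, σ c) ∈ F.cells ∧ σ d ≤ σ c

theorem fillingAvoidsSet_Aset_iff {n : ℕ} {F : FerrersBoard n} {σ : Equiv.Perm (Fin n)}
    (hσ : IsFilling F σ) {k : ℕ} (t : Fin k) :
    FillingAvoidsSet F σ (Aset k t) ↔ ∀ c,
      ¬ ((t : ℕ) ≤ ((columnsBelow F σ c).filter (· < c)).card ∧
        k - 1 - t ≤ ((columnsBelow F σ c).filter (c < ·)).card) := by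
  have hmem : ∀ c, c ∈ columnsBelow F σ c := fun c => by simpa [columnsBelow] using hσ c
  simp only [← exists_strictMono_apply_eq_iff _ (hmem _)]
  constructor
  · rintro h c ⟨f, hf, hfX, rfl⟩
    simp only [columnsBelow, Finset.mem_filter, Finset.mem_univ, true_and] at hfX
    obtain ⟨p, hp⟩ := exists_perm_lt_iff_lt (σ.injective.comp hf.injective)
    refine h ⟨k, p⟩ ⟨p, fun a => ?_, rfl⟩ ⟨f, hf, hp, fun a b => ?_⟩
    · rw [← not_lt, ← hp, not_lt]
      exact (hfX a).2
    · exact F.downward_closed (hfX a).1 le_rfl (hfX b).2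
  · rintro h _ ⟨p, hp, rfl⟩ ⟨f, hf, hlt, hF⟩
    refine h (f t) ⟨f, hf, fun a => ?_, rfl⟩
    simp only [columnsBelow, Finset.mem_filter, Finset.mem_univ, true_and]
    refine ⟨hF a t, ?_⟩
    rw [← not_lt, hlt, not_lt]
    exact hp a

open Classical in
/-- The columns meeting the board in the row with exactly `i` rows above it
(all columns, if there is no such row). -/
noncomputable def rowColumns {n : ℕ} (F : FerrersBoard n) (i : ℕ) : Finset (Fin n) :=
  Finset.univ.filter fun c => ∀ r : Fin n, (r : ℕ) + i + 1 = n → (c, r) ∈ F.cells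

/-- When the rows of a filling are filled from top to bottom and `T` is the set of columns
used so far, these are the columns for the next row that create no occurrence of a pattern
of `Aset k t` with its maximum in that row. -/
noncomputable def nextColumns {n : ℕ} (F : FerrersBoard n) {k : ℕ} (t : Fin k)
    (T : Finset (Fin n)) : Finset (Fin n) :=
  (rowColumns F T.card \ T).filter fun c =>
    ¬ ((t : ℕ) ≤ ((rowColumns F T.card \ T).filter (· < c)).card ∧
      k - 1 - t ≤ ((rowColumns F T.card \ T).filter (c < ·)).card)

theorem notMem_of_mem_nextColumns {n : ℕ} (F : FerrersBoard n) {k : ℕ} (t : Fin k)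
    (T : Finset (Fin n)) : ∀ x ∈ nextColumns F t T, x ∉ T := fun _ hx =>
  (Finset.mem_sdiff.1 (Finset.mem_filter.1 hx).1).2

theorem rowColumns_subset_succ {n : ℕ} (F : FerrersBoard n) (i : ℕ) :
    rowColumns F i ⊆ rowColumns F (i + 1) := by
  intro c
  simp only [rowColumns, Finset.mem_filter, Finset.mem_univ, true_and]
  intro h r hr
  exact F.downward_closed (h ⟨r + 1, by omega⟩ (by simp only; omega)) le_rfl
    (Fin.le_def.2 (Nat.le_succ _))

theorem card_sequentialChoice_nextColumns {n : ℕ} (F : FerrersBoard n) {k : ℕ} (t : Fin k)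
    (m : ℕ) : Nat.card {f : Fin m → Fin n // IsSequentialChoice (nextColumns F t) f} =
      ∏ i ∈ Finset.range m, min ((rowColumns F i).card - i) (k - 1) := by
  refine card_sequentialChoice (c := fun i => min ((rowColumns F i).card - i) (k - 1))
    (notMem_of_mem_nextColumns F t) (I := fun T => T ⊆ rowColumns F T.card)
    (Finset.empty_subset _) (fun T hT x hx => ?_) (fun T hT => ?_) m
  · have hxT := notMem_of_mem_nextColumns F t T x hx
    rw [Finset.card_insert_of_notMem hxT]
    refine (Finset.insert_subset ?_ hT).trans (rowColumns_subset_succ F _)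
    exact (Finset.mem_sdiff.1 (Finset.mem_filter.1 hx).1).1
  · rw [nextColumns, card_filter_not_le_rank, Finset.card_sdiff_of_subset hT]
    congr 1
    omega

theorem mem_rowColumns_iff {n : ℕ} (F : FerrersBoard n) (i c : Fin n) :
    c ∈ rowColumns F i ↔ (c, i.rev) ∈ F.cells := by
  simp only [rowColumns, Finset.mem_filter, Finset.mem_univ, true_and]
  constructor
  · intro h
    exact h _ (by rw [Fin.val_rev]; omega)
  · intro h r hr
    have : r = i.rev := by
      ext
      rw [Fin.val_rev]
      omega
    rwa [this]

theorem isFilling_and_avoids_iff {n : ℕ} (F : FerrersBoard n) {k : ℕ} (t : Fin k)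
    (σ : Equiv.Perm (Fin n)) :
    IsFilling F σ ∧ FillingAvoidsSet F σ (Aset k t) ↔
      IsSequentialChoice (nextColumns F t) (fun i => σ.symm i.rev) := by
  have himage : ∀ i : Fin n, (Finset.Iio i).image (fun j => σ.symm j.rev) =
      Finset.univ.filter (fun d => i.rev < σ d) := by
    intro i
    ext d
    simp only [Finset.mem_image, Finset.mem_Iio, Finset.mem_filter, Finset.mem_univ, true_and]
    constructor
    · rintro ⟨j, hj, rfl⟩
      simpa using hj
    · intro h
      exact ⟨(σ d).rev, by rwa [← Fin.rev_lt_rev, Fin.rev_rev], by simp⟩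
  have hcard : ∀ i : Fin n, ((Finset.Iio i).image (fun j => σ.symm j.rev)).card = i := by
    intro i
    exact (Finset.card_image_of_injective _ (σ.symm.injective.comp Fin.rev_injective)).trans
      (Fin.card_Iio i)
  have hfree : ∀ i : Fin n, rowColumns F i \ Finset.univ.filter (fun d => i.rev < σ d) =
      columnsBelow F σ (σ.symm i.rev) := by
    intro i
    ext d
    simp [columnsBelow, mem_rowColumns_iff]
  have hmem : ∀ c, c ∈ columnsBelow F σ c ↔ (c, σ c) ∈ F.cells := fun c => by
    simp [columnsBelow]
  have hstep : IsSequentialChoice (nextColumns F t) (fun i => σ.symm i.rev) ↔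
      ∀ c, (c, σ c) ∈ F.cells ∧
        ¬ ((t : ℕ) ≤ ((columnsBelow F σ c).filter (· < c)).card ∧
          k - 1 - t ≤ ((columnsBelow F σ c).filter (c < ·)).card) := by
    simp only [IsSequentialChoice, nextColumns, hcard]
    simp only [himage, hfree, Finset.mem_filter, hmem]
    exact (Fin.revPerm.trans σ.symm).forall_congr_right
      (q := fun c => (c, σ c) ∈ F.cells ∧
        ¬ ((t : ℕ) ≤ ((columnsBelow F σ c).filter (· < c)).card ∧
          k - 1 - t ≤ ((columnsBelow F σ c).filter (c < ·)).card))
  rw [hstep, forall_and]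
  exact and_congr_right fun hσ => fillingAvoidsSet_Aset_iff hσ t

theorem card_fillings_avoiding_Aset {n : ℕ} (F : FerrersBoard n) {k : ℕ} (t : Fin k) :
    Nat.card {σ : Equiv.Perm (Fin n) // IsFilling F σ ∧ FillingAvoidsSet F σ (Aset k t)} =
      ∏ i ∈ Finset.range n, min ((rowColumns F i).card - i) (k - 1) := by
  rw [← card_sequentialChoice_nextColumns F t n]
  refine Nat.card_eq_of_bijective
    (fun σ => ⟨fun i => σ.1.symm i.rev, (isFilling_and_avoids_iff F t σ.1).1 σ.2⟩) ⟨?_, ?_⟩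
  · rintro ⟨σ, hσ⟩ ⟨τ, hτ⟩ h
    have h' : ∀ i, σ.symm i = τ.symm i := fun i => by
      simpa using congrFun (congrArg Subtype.val h) i.rev
    have : σ.symm = τ.symm := Equiv.ext h'
    exact Subtype.ext (Equiv.symm_bijective.injective this)
  · rintro ⟨f, hf⟩
    have hbij := Finite.injective_iff_bijective.1
      (hf.injective (notMem_of_mem_nextColumns F t))
    have hσ : (fun i : Fin n =>
        (Fin.revPerm.trans (Equiv.ofBijective f hbij)).symm.symm i.rev) = f := by
      ext i
      simp
    refine ⟨⟨(Fin.revPerm.trans (Equiv.ofBijective f hbij)).symm,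
      (isFilling_and_avoids_iff F t _).2 (by rwa [hσ])⟩, Subtype.ext hσ⟩

end Ferrers

/-- For every `k ≥ 1` and all positions `t1, t2` in `{1, …, k}`, the pattern sets
`A_{k,t1}` and `A_{k,t2}` are shape-Wilf-equivalent. -/
theorem stmt4 (k : ℕ) (hk : 1 ≤ k) (t1 t2 : Fin k) :
    ShapeWilfEquiv (Aset k t1) (Aset k t2) := by
  intro n _ F
  rw [card_fillings_avoiding_Aset, card_fillings_avoiding_Aset]
end

section
/- For every t ∈ {1,2,3}, the pattern set A_{3,t} (namely {312,321} for t=1, {132,231} for t=2, and {123,213} for t=3) is shape-Wilf-equivalent to the pattern set {213, 312}. -/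
/-- `TripleAvoids F σ Q`: no three rooks of `σ` whose spanned rectangle lies in `F` have heights,
read from left to right, satisfying `Q`. -/
def TripleAvoids {n : ℕ} (F : FerrersBoard n) (σ : Equiv.Perm (Fin n))
    (Q : ℕ → ℕ → ℕ → Prop) : Prop :=
  ∀ i j k : Fin n, i < j → j < k → (k, σ i) ∈ F.cells → (k, σ j) ∈ F.cells →
    (k, σ k) ∈ F.cells → ¬ Q (σ i) (σ j) (σ k)

/-- `σ` is a filling of `F` avoiding the ternary relation `Q`. -/
def GoodFilling {n : ℕ} (F : FerrersBoard n) (Q : ℕ → ℕ → ℕ → Prop)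
    (σ : Equiv.Perm (Fin n)) : Prop :=
  IsFilling F σ ∧ TripleAvoids F σ Q

/-- Delete the top row and one column of a Ferrers board. -/
def FerrersBoard.deleteTop {n : ℕ} (F : FerrersBoard (n + 1)) : FerrersBoard n where
  cells := {x | (x.1.succ, x.2.castSucc) ∈ F.cells}
  downward_closed := fun _ _ _ _ h hi hj =>
    F.downward_closed h (Fin.succ_le_succ_iff.2 hi) (Fin.castSucc_le_castSucc_iff.2 hj)

/-- Insert a new maximum at position `c` in a permutation. -/
def insertMax {n : ℕ} (c : Fin (n + 1)) (τ : Equiv.Perm (Fin n)) : Equiv.Perm (Fin (n + 1)) :=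
  ((finSuccEquiv' c).trans (Equiv.optionCongr τ)).trans (finSuccEquiv' (Fin.last n)).symm

@[simp]
theorem insertMax_self {n : ℕ} (c : Fin (n + 1)) (τ : Equiv.Perm (Fin n)) :
    insertMax c τ c = Fin.last n := by
  simp [insertMax]

@[simp]
theorem insertMax_succAbove {n : ℕ} (c : Fin (n + 1)) (τ : Equiv.Perm (Fin n)) (i : Fin n) :
    insertMax c τ (c.succAbove i) = (τ i).castSucc := by
  simp [insertMax]

theorem insertMax_bijective (n : ℕ) :
    Function.Bijective
      (fun x : Fin (n + 1) × Equiv.Perm (Fin n) => insertMax x.1 x.2) := by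
  rw [Fintype.bijective_iff_injective_and_card]
  refine ⟨?_, by simp [Fintype.card_perm, Nat.factorial_succ]⟩
  rintro ⟨c, τ⟩ ⟨d, ρ⟩ h
  have h' : insertMax c τ = insertMax d ρ := h
  have hcd : c = d := by
    apply (insertMax d ρ).injective
    rw [insertMax_self, ← h', insertMax_self]
  subst hcd
  congr 1
  ext i
  have := congrArg (fun σ : Equiv.Perm (Fin (n + 1)) => (σ (c.succAbove i)).val) h'
  simpa using this

/-- Cells of the smaller board correspond to cells of the larger one outside column `c`. -/
theorem mem_cells_succAbove {n : ℕ} (F : FerrersBoard (n + 1)) {c : Fin (n + 1)}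
    (hc : (c, Fin.last n) ∈ F.cells) (i j : Fin n) :
    (c.succAbove i, j.castSucc) ∈ F.cells ↔ (i, j) ∈ F.deleteTop.cells := by
  change _ ↔ (i.succ, j.castSucc) ∈ F.cells
  rcases lt_or_ge i.castSucc c with h | h
  · have h1 : i.succ ≤ c := by
      simp only [Fin.le_def, Fin.lt_def, Fin.val_succ, Fin.val_castSucc] at *; omega
    rw [Fin.succAbove_of_castSucc_lt _ _ h]
    exact iff_of_true (F.downward_closed hc h.le (Fin.le_last _))
      (F.downward_closed hc h1 (Fin.le_last _))
  · rw [Fin.succAbove_of_le_castSucc _ _ h]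

theorem self_lt_succAbove_iff {n : ℕ} (c : Fin (n + 1)) (i : Fin n) :
    c < c.succAbove i ↔ c.val ≤ i.val := by
  rw [Fin.lt_succAbove_iff_le_castSucc]; rfl

theorem succAbove_lt_self_iff {n : ℕ} (c : Fin (n + 1)) (i : Fin n) :
    c.succAbove i < c ↔ i.val < c.val := by
  rw [Fin.succAbove_lt_iff_castSucc_lt]; rfl

/-- Avoidance after inserting a new maximum: the smaller filling avoids `Q`, and so do the
triples containing the new maximum. Here `L` is the length of the top row of `F`. -/
theorem goodFilling_insertMax_iff {n : ℕ} (F : FerrersBoard (n + 1)) (Q : ℕ → ℕ → ℕ → Prop)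
    {L : ℕ} (hL : ∀ c, (c, Fin.last n) ∈ F.cells ↔ c.val < L)
    (c : Fin (n + 1)) (τ : Equiv.Perm (Fin n)) :
    GoodFilling F Q (insertMax c τ) ↔ c.val < L ∧ GoodFilling F.deleteTop Q τ ∧
      (∀ j k : Fin n, c.val ≤ j.val → j < k → k.val + 1 < L → ¬ Q n (τ j) (τ k)) ∧
      (∀ i k : Fin n, i.val < c.val → c.val ≤ k.val → k.val + 1 < L → ¬ Q (τ i) n (τ k)) ∧
      (∀ i j : Fin n, i < j → j.val < c.val → ¬ Q (τ i) (τ j) n) := by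
  by_cases hc : (c, Fin.last n) ∈ F.cells
  swap
  · refine iff_of_false (fun h => hc ?_) (fun h => hc ((hL c).2 h.1))
    simpa using h.1 c
  have key := mem_cells_succAbove F hc
  have top : ∀ k : Fin n, c.val ≤ k.val →
      ((c.succAbove k, Fin.last n) ∈ F.cells ↔ k.val + 1 < L) := by
    intro k hk
    rw [Fin.succAbove_of_le_castSucc _ _ (by simpa [Fin.le_def] using hk), hL, Fin.val_succ]
  have low : ∀ (k : Fin (n + 1)) (y : Fin (n + 1)), (k, Fin.last n) ∈ F.cells →
      (k, y) ∈ F.cells := fun k y h => F.downward_closed h le_rfl (Fin.le_last _)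
  constructor
  · rintro ⟨hfill, hav⟩
    refine ⟨(hL c).1 hc, ⟨fun i => ?_, ?_⟩, ?_, ?_, ?_⟩
    · rw [← key]; simpa using hfill (c.succAbove i)
    · intro i j k hij hjk h1 h2 h3
      simpa using hav (c.succAbove i) (c.succAbove j) (c.succAbove k)
        (Fin.succAbove_lt_succAbove_iff.2 hij) (Fin.succAbove_lt_succAbove_iff.2 hjk)
        (by simpa [key] using h1) (by simpa [key] using h2) (by simpa [key] using h3)
    · intro j k hj hjk hk
      have hk' := (top k (hj.trans (le_of_lt hjk))).2 hk
      simpa using hav c (c.succAbove j) (c.succAbove k) ((self_lt_succAbove_iff _ _).2 hj)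
        (Fin.succAbove_lt_succAbove_iff.2 hjk) (low _ _ hk') (low _ _ hk') (low _ _ hk')
    · intro i k hi hk hkL
      have hk' := (top k hk).2 hkL
      simpa using hav (c.succAbove i) c (c.succAbove k) ((succAbove_lt_self_iff _ _).2 hi)
        ((self_lt_succAbove_iff _ _).2 hk) (low _ _ hk') (low _ _ hk') (low _ _ hk')
    · intro i j hij hj
      simpa using hav (c.succAbove i) (c.succAbove j) c (Fin.succAbove_lt_succAbove_iff.2 hij)
        ((succAbove_lt_self_iff _ _).2 hj) (low _ _ hc) (low _ _ hc) (low _ _ hc)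
  · rintro ⟨-, ⟨hfill, hav⟩, hfst, hmid, hlst⟩
    refine ⟨fun i => ?_, fun i j k hij hjk h1 h2 h3 => ?_⟩
    · rcases Fin.eq_self_or_eq_succAbove c i with rfl | ⟨i, rfl⟩
      · simpa using hc
      · simpa [key] using hfill i
    · rcases Fin.eq_self_or_eq_succAbove c i with rfl | ⟨i, rfl⟩
      · obtain ⟨j, rfl⟩ := Fin.exists_succAbove_eq hij.ne'
        obtain ⟨k, rfl⟩ := Fin.exists_succAbove_eq (hij.trans hjk).ne'
        rw [self_lt_succAbove_iff] at hij
        rw [Fin.succAbove_lt_succAbove_iff] at hjk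
        rw [insertMax_self, top k (hij.trans (le_of_lt hjk))] at h1
        simpa using hfst j k hij hjk h1
      rcases Fin.eq_self_or_eq_succAbove c j with rfl | ⟨j, rfl⟩
      · obtain ⟨k, rfl⟩ := Fin.exists_succAbove_eq hjk.ne'
        rw [succAbove_lt_self_iff] at hij
        rw [self_lt_succAbove_iff] at hjk
        rw [insertMax_self, top k hjk] at h2
        simpa using hmid i k hij hjk h2
      rw [Fin.succAbove_lt_succAbove_iff] at hij
      rcases Fin.eq_self_or_eq_succAbove c k with rfl | ⟨k, rfl⟩
      · rw [succAbove_lt_self_iff] at hjk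
        simpa using hlst i j hij hjk
      rw [Fin.succAbove_lt_succAbove_iff] at hjk
      simp only [insertMax_succAbove, key] at h1 h2 h3
      simpa using hav i j k hij hjk h1 h2 h3

/-- When the top row has at least two cells, every good filling of the smaller board extends in
exactly two ways. -/
def HasTwoExtensions (Q : ℕ → ℕ → ℕ → Prop) : Prop :=
  ∀ (n : ℕ) (F : FerrersBoard (n + 1)) (L : ℕ), L ≤ n + 1 →
    (∀ c, (c, Fin.last n) ∈ F.cells ↔ c.val < L) → 2 ≤ L →
    ∀ τ : Equiv.Perm (Fin n), GoodFilling F.deleteTop Q τ →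
      ∃ x : ℕ, ∃ y : ℕ, x < y ∧ y ≤ n ∧
        ∀ c : Fin (n + 1), GoodFilling F Q (insertMax c τ) ↔ c.val = x ∨ c.val = y

theorem card_extensions {Q : ℕ → ℕ → ℕ → Prop} (hQ : HasTwoExtensions Q) {n : ℕ}
    (F : FerrersBoard (n + 1)) {L : ℕ} (hLn : L ≤ n + 1)
    (hL : ∀ c, (c, Fin.last n) ∈ F.cells ↔ c.val < L) {τ : Equiv.Perm (Fin n)}
    (hτ : GoodFilling F.deleteTop Q τ) :
    Nat.card {c // GoodFilling F Q (insertMax c τ)} = min 2 L := by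
  rcases Nat.lt_or_ge L 2 with h | h
  · have hiff : ∀ c, GoodFilling F Q (insertMax c τ) ↔ c.val < L := fun c => by
      rw [goodFilling_insertMax_iff F Q hL]
      refine ⟨fun h => h.1, fun hc => ⟨hc, hτ, ?_, ?_, ?_⟩⟩ <;> intros <;> omega
    simp only [hiff]
    rw [Nat.card_eq_fintype_card, Fintype.card_subtype, Fin.card_filter_val_lt]
    omega
  · obtain ⟨x, y, hxy, hy, hiff⟩ := hQ n F L hLn hL h τ hτ
    have hset : {c : Fin (n + 1) | GoodFilling F Q (insertMax c τ)} =
        {⟨x, by omega⟩, ⟨y, by omega⟩} := by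
      ext c
      simp [hiff, Fin.ext_iff]
    change Nat.card ↥{c | GoodFilling F Q (insertMax c τ)} = _
    rw [hset, Nat.card_coe_set_eq, Set.ncard_pair (by simp [Fin.ext_iff]; omega)]
    omega

theorem card_goodFilling_succ {Q : ℕ → ℕ → ℕ → Prop} (hQ : HasTwoExtensions Q) {n : ℕ}
    (F : FerrersBoard (n + 1)) {L : ℕ} (hLn : L ≤ n + 1)
    (hL : ∀ c, (c, Fin.last n) ∈ F.cells ↔ c.val < L) :
    Nat.card {σ // GoodFilling F Q σ} =
      Nat.card {τ // GoodFilling F.deleteTop Q τ} * min 2 L := by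
  have hmono : ∀ c τ, GoodFilling F Q (insertMax c τ) → GoodFilling F.deleteTop Q τ :=
    fun c τ h => ((goodFilling_insertMax_iff F Q hL c τ).1 h).2.1
  let e : (Σ τ : {τ // GoodFilling F.deleteTop Q τ},
      {c // GoodFilling F Q (insertMax c τ.1)}) ≃ {σ // GoodFilling F Q σ} :=
    Equiv.ofBijective (fun x => ⟨insertMax x.2.1 x.1.1, x.2.2⟩) (by
      constructor
      · rintro ⟨⟨τ, hτ⟩, c, hc⟩ ⟨⟨ρ, hρ⟩, d, hd⟩ h
        have h' := (insertMax_bijective n).1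
          (a₁ := (c, τ)) (a₂ := (d, ρ)) (congrArg Subtype.val h)
        obtain ⟨rfl, rfl⟩ := Prod.mk.inj h'
        rfl
      · rintro ⟨σ, hσ⟩
        obtain ⟨⟨c, τ⟩, rfl⟩ := (insertMax_bijective n).2 σ
        exact ⟨⟨⟨τ, hmono c τ hσ⟩, c, hσ⟩, rfl⟩)
  classical
  rw [← Nat.card_congr e, Nat.card_sigma,
    Finset.sum_congr rfl (fun τ _ => card_extensions hQ F hLn hL τ.2)]
  simp [Nat.card_eq_fintype_card]

theorem exists_topRow_length {n : ℕ} (F : FerrersBoard (n + 1)) :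
    ∃ L ≤ n + 1, ∀ c, (c, Fin.last n) ∈ F.cells ↔ c.val < L := by
  classical
  have hex : ∃ m, ∀ c : Fin (n + 1), m ≤ c.val → (c, Fin.last n) ∉ F.cells :=
    ⟨n + 1, fun c hc => absurd c.2 (by omega)⟩
  refine ⟨Nat.find hex, Nat.find_min' hex fun c hc => absurd c.2 (by omega), fun c => ?_⟩
  constructor
  · intro hc
    by_contra hlt
    exact Nat.find_spec hex c (not_lt.1 hlt) hc
  · intro hc
    have := Nat.find_min hex hc
    push Not at this
    obtain ⟨d, hd, hdF⟩ := this
    exact F.downward_closed hdF hd le_rfl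

theorem card_goodFilling_eq {Q R : ℕ → ℕ → ℕ → Prop} (hQ : HasTwoExtensions Q)
    (hR : HasTwoExtensions R) {n : ℕ} (F : FerrersBoard n) :
    Nat.card {σ // GoodFilling F Q σ} = Nat.card {σ // GoodFilling F R σ} := by
  induction n with
  | zero =>
    have h : ∀ (P : ℕ → ℕ → ℕ → Prop) σ, GoodFilling F P σ := fun P σ =>
      ⟨fun i => i.elim0, fun i => i.elim0⟩
    simp [h]
  | succ n ih =>
    obtain ⟨L, hLn, hL⟩ := exists_topRow_length F
    rw [card_goodFilling_succ hQ F hLn hL, card_goodFilling_succ hR F hLn hL, ih]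

theorem hasTwoExtensions_max_first : HasTwoExtensions (fun a b c => b < a ∧ c < a) := by
  intro n F L hLn hL h2 τ hτ
  refine ⟨L - 2, L - 1, by omega, by omega, fun c => ?_⟩
  rw [goodFilling_insertMax_iff F _ hL]
  constructor
  · rintro ⟨hc, -, h, -, -⟩
    by_contra hne
    exact h ⟨c.val, by omega⟩ ⟨c.val + 1, by omega⟩ le_rfl (by simp [Fin.lt_def])
      (by simp; omega) ⟨Fin.is_lt _, Fin.is_lt _⟩
  · intro hc
    refine ⟨by omega, hτ, ?_, ?_, ?_⟩
    · intro j k _ _ _; simp only [Fin.lt_def] at *; omega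
    · intro i k _ _ _; omega
    · intro i j _ _; omega

theorem hasTwoExtensions_max_middle : HasTwoExtensions (fun a b c => a < b ∧ c < b) := by
  intro n F L hLn hL h2 τ hτ
  refine ⟨0, L - 1, by omega, by omega, fun c => ?_⟩
  rw [goodFilling_insertMax_iff F _ hL]
  constructor
  · rintro ⟨hc, -, -, h, -⟩
    by_contra hne
    exact h ⟨0, by omega⟩ ⟨c.val, by omega⟩ (show 0 < c.val by omega) le_rfl
      (by simp; omega) ⟨Fin.is_lt _, Fin.is_lt _⟩
  · intro hc
    refine ⟨by omega, hτ, ?_, ?_, ?_⟩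
    · intro j k _ _ _; omega
    · intro i k _ _ _; omega
    · intro i j _ _; omega

theorem hasTwoExtensions_max_last : HasTwoExtensions (fun a b c => a < c ∧ b < c) := by
  intro n F L hLn hL h2 τ hτ
  refine ⟨0, 1, by omega, by omega, fun c => ?_⟩
  rw [goodFilling_insertMax_iff F _ hL]
  constructor
  · rintro ⟨hc, -, -, -, h⟩
    by_contra hne
    exact h ⟨0, by omega⟩ ⟨1, by omega⟩ (by simp [Fin.lt_def])
      (by simp; omega) ⟨Fin.is_lt _, Fin.is_lt _⟩
  · intro hc
    refine ⟨by omega, hτ, ?_, ?_, ?_⟩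
    · intro j k _ _ _; omega
    · intro i k _ _ _; omega
    · intro i j _ _; simp only [Fin.lt_def] at *; omega

theorem hasTwoExtensions_min_middle : HasTwoExtensions (fun a b c => b < a ∧ b < c) := by
  intro n F L hLn hL h2 τ hτ
  have valley : ∀ i j k : Fin n, i < j → j < k → k.val + 1 < L → ¬ (τ j < τ i ∧ τ j < τ k) := by
    intro i j k hij hjk hk
    have hrow : ∀ y, (k, y) ∈ F.deleteTop.cells := fun y =>
      F.downward_closed ((hL k.succ).2 (by simpa using hk)) le_rfl (Fin.le_last _)
    simpa using hτ.2 i j k hij hjk (hrow _) (hrow _) (hrow _)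
  obtain ⟨m, hmL, hmax⟩ : ∃ m : Fin n, m.val + 1 < L ∧
      ∀ i : Fin n, i.val + 1 < L → τ i ≤ τ m := by
    have hne : (Finset.univ.filter fun i : Fin n => i.val + 1 < L).Nonempty :=
      ⟨⟨0, by omega⟩, by simp; omega⟩
    obtain ⟨m, hm, hmax⟩ := Finset.exists_max_image _ τ hne
    exact ⟨m, by simpa using hm, fun i hi => hmax i (by simpa using hi)⟩
  have hlt : ∀ i : Fin n, i.val + 1 < L → i ≠ m → τ i < τ m := fun i hi hne =>
    lt_of_le_of_ne (hmax i hi) (τ.injective.ne hne)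
  refine ⟨m.val, m.val + 1, by omega, by omega, fun c => ?_⟩
  rw [goodFilling_insertMax_iff F _ hL]
  constructor
  · rintro ⟨hc, -, hfst, -, hlst⟩
    by_contra hne
    rcases lt_or_ge c.val m.val with h | h
    · have hcn : c.val < n := by omega
      exact hfst ⟨c.val, hcn⟩ m le_rfl h hmL
        ⟨Fin.is_lt _, hlt _ (by simp; omega) (by simp [Fin.ext_iff]; omega)⟩
    · have hcn : m.val + 1 < n := by omega
      exact hlst m ⟨m.val + 1, hcn⟩ (by simp [Fin.lt_def]) (by simp; omega)
        ⟨hlt _ (by simp; omega) (by simp [Fin.ext_iff]), Fin.is_lt _⟩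
  · intro hc
    refine ⟨by omega, hτ, ?_, ?_, ?_⟩
    · rintro j k hj hjk hk ⟨-, h⟩
      have hjk' : j.val < k.val := hjk
      have hkm : τ k < τ m := hlt k hk (by rintro rfl; omega)
      have hjm : m < j := by
        refine lt_of_le_of_ne (by rw [Fin.le_def]; omega) ?_
        rintro rfl
        exact lt_asymm h hkm
      exact valley m j k hjm hjk hk ⟨lt_trans h hkm, h⟩
    · rintro i k - - - ⟨h, -⟩
      exact absurd (τ i).2 (by omega)
    · rintro i j hij hj ⟨h, -⟩
      have hij' : i.val < j.val := hij
      have him : τ i < τ m := hlt i (by omega) (by rintro rfl; omega)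
      have hjm : j < m := by
        refine lt_of_le_of_ne (by rw [Fin.le_def]; omega) ?_
        rintro rfl
        exact lt_asymm h him
      exact valley i j m hij hjm hmL ⟨h, lt_trans h him⟩

/-- Three rooks order-isomorphic to `v` form an occurrence of `mkPattern v`. -/
theorem fillingContains_mkPattern {n : ℕ} {F : FerrersBoard n} {σ : Equiv.Perm (Fin n)}
    {i j k : Fin n} (hij : i < j) (hjk : j < k) (h1 : (k, σ i) ∈ F.cells)
    (h2 : (k, σ j) ∈ F.cells) (h3 : (k, σ k) ∈ F.cells) {v : Fin 3 → Fin 3}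
    (hv : Function.Bijective v)
    (h : ∀ a b, σ (![i, j, k] a) < σ (![i, j, k] b) ↔ v a < v b) :
    FillingContains F σ (mkPattern v hv) := by
  refine ⟨![i, j, k], ?_, h, ?_⟩
  · change StrictMono (![i, j, k] : Fin 3 → Fin n)
    rw [Fin.strictMono_iff_lt_succ]
    intro a
    fin_cases a
    · exact hij
    · exact hjk
  · have hle : ∀ a : Fin 3, ![i, j, k] a ≤ k := by
      intro a
      fin_cases a
      · exact (hij.trans hjk).le
      · exact hjk.le
      · exact le_rfl
    have hrow : ∀ b : Fin 3, (k, σ (![i, j, k] b)) ∈ F.cells := by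
      intro b
      fin_cases b
      · exact h1
      · exact h2
      · exact h3
    exact fun a b => F.downward_closed (hrow b) (hle a) le_rfl

theorem mkPattern_mem_Aset {v : Fin 3 → Fin 3} (hv : Function.Bijective v) {t : Fin 3}
    (h : ∀ a, v a ≤ v t) : mkPattern v hv ∈ Aset 3 t :=
  ⟨Equiv.ofBijective v hv, h, rfl⟩

/-- An occurrence of a pattern of length three, as a triple of rooks. -/
theorem not_fillingContains_of_tripleAvoids {n : ℕ} {F : FerrersBoard n}
    {σ : Equiv.Perm (Fin n)} {Q : ℕ → ℕ → ℕ → Prop} (hav : TripleAvoids F σ Q)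
    {p : Equiv.Perm (Fin 3)}
    (h : ∀ x : Fin 3 → Fin n, (∀ a b, x a < x b ↔ p a < p b) → Q (x 0) (x 1) (x 2)) :
    ¬ FillingContains F σ ⟨3, p⟩ := by
  rintro ⟨f, hf, hord, hcell⟩
  exact hav (f (0 : Fin 3)) (f (1 : Fin 3)) (f (2 : Fin 3))
    (hf (show (0 : Fin 3) < 1 by decide)) (hf (show (1 : Fin 3) < 2 by decide))
    (hcell _ _) (hcell _ _) (hcell _ _) (h (fun a => σ (f a)) hord)

theorem fillingAvoidsSet_pair_iff {n : ℕ} (F : FerrersBoard n) (σ : Equiv.Perm (Fin n)) :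
    FillingAvoidsSet F σ {mkPattern ![1,0,2], mkPattern ![2,0,1]} ↔
      TripleAvoids F σ (fun a b c => b < a ∧ b < c) := by
  constructor
  · rintro h i j k hij hjk h1 h2 h3 ⟨hab, hbc⟩
    have hne : σ i ≠ σ k := σ.injective.ne (hij.trans hjk).ne
    rcases lt_or_gt_of_ne hne with hlt | hlt
    · refine h (mkPattern ![1,0,2]) (by simp) (fillingContains_mkPattern hij hjk h1 h2 h3 _ ?_)
      simp only [Fin.forall_fin_succ, Fin.lt_def] at *
      simp; omega
    · refine h (mkPattern ![2,0,1]) (by simp) (fillingContains_mkPattern hij hjk h1 h2 h3 _ ?_)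
      simp only [Fin.forall_fin_succ, Fin.lt_def] at *
      simp; omega
  · intro hav p hp
    rcases hp with rfl | rfl
    · exact not_fillingContains_of_tripleAvoids hav fun x hx =>
        ⟨(hx 1 0).2 (by decide), (hx 1 2).2 (by decide)⟩
    · exact not_fillingContains_of_tripleAvoids hav fun x hx =>
        ⟨(hx 1 0).2 (by decide), (hx 1 2).2 (by decide)⟩

theorem perm_lt_of_max {p : Equiv.Perm (Fin 3)} {t : Fin 3} (h : ∀ a, p a ≤ p t) {a : Fin 3}
    (ha : a ≠ t) : p a < p t :=
  lt_of_le_of_ne (h a) (p.injective.ne ha)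

theorem fillingAvoidsSet_Aset_zero_iff {n : ℕ} (F : FerrersBoard n) (σ : Equiv.Perm (Fin n)) :
    FillingAvoidsSet F σ (Aset 3 0) ↔ TripleAvoids F σ (fun a b c => b < a ∧ c < a) := by
  constructor
  · rintro h i j k hij hjk h1 h2 h3 ⟨hab, hbc⟩
    rcases lt_or_gt_of_ne (σ.injective.ne hjk.ne) with hlt | hlt
    · refine h _ (mkPattern_mem_Aset (v := ![2,0,1]) (by decide) (by decide))
        (fillingContains_mkPattern hij hjk h1 h2 h3 _ ?_)
      simp only [Fin.forall_fin_succ, Fin.lt_def] at *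
      simp; omega
    · refine h _ (mkPattern_mem_Aset (v := ![2,1,0]) (by decide) (by decide))
        (fillingContains_mkPattern hij hjk h1 h2 h3 _ ?_)
      simp only [Fin.forall_fin_succ, Fin.lt_def] at *
      simp; omega
  · rintro hav _ ⟨p, hp, rfl⟩
    exact not_fillingContains_of_tripleAvoids hav fun x hx =>
      ⟨(hx 1 0).2 (perm_lt_of_max hp (by decide)), (hx 2 0).2 (perm_lt_of_max hp (by decide))⟩

theorem fillingAvoidsSet_Aset_one_iff {n : ℕ} (F : FerrersBoard n) (σ : Equiv.Perm (Fin n)) :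
    FillingAvoidsSet F σ (Aset 3 1) ↔ TripleAvoids F σ (fun a b c => a < b ∧ c < b) := by
  constructor
  · rintro h i j k hij hjk h1 h2 h3 ⟨hab, hbc⟩
    rcases lt_or_gt_of_ne (σ.injective.ne (hij.trans hjk).ne) with hlt | hlt
    · refine h _ (mkPattern_mem_Aset (v := ![0,2,1]) (by decide) (by decide))
        (fillingContains_mkPattern hij hjk h1 h2 h3 _ ?_)
      simp only [Fin.forall_fin_succ, Fin.lt_def] at *
      simp; omega
    · refine h _ (mkPattern_mem_Aset (v := ![1,2,0]) (by decide) (by decide))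
        (fillingContains_mkPattern hij hjk h1 h2 h3 _ ?_)
      simp only [Fin.forall_fin_succ, Fin.lt_def] at *
      simp; omega
  · rintro hav _ ⟨p, hp, rfl⟩
    exact not_fillingContains_of_tripleAvoids hav fun x hx =>
      ⟨(hx 0 1).2 (perm_lt_of_max hp (by decide)), (hx 2 1).2 (perm_lt_of_max hp (by decide))⟩

theorem fillingAvoidsSet_Aset_two_iff {n : ℕ} (F : FerrersBoard n) (σ : Equiv.Perm (Fin n)) :
    FillingAvoidsSet F σ (Aset 3 2) ↔ TripleAvoids F σ (fun a b c => a < c ∧ b < c) := by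
  constructor
  · rintro h i j k hij hjk h1 h2 h3 ⟨hab, hbc⟩
    rcases lt_or_gt_of_ne (σ.injective.ne hij.ne) with hlt | hlt
    · refine h _ (mkPattern_mem_Aset (v := ![0,1,2]) (by decide) (by decide))
        (fillingContains_mkPattern hij hjk h1 h2 h3 _ ?_)
      simp only [Fin.forall_fin_succ, Fin.lt_def] at *
      simp; omega
    · refine h _ (mkPattern_mem_Aset (v := ![1,0,2]) (by decide) (by decide))
        (fillingContains_mkPattern hij hjk h1 h2 h3 _ ?_)
      simp only [Fin.forall_fin_succ, Fin.lt_def] at *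
      simp; omega
  · rintro hav _ ⟨p, hp, rfl⟩
    exact not_fillingContains_of_tripleAvoids hav fun x hx =>
      ⟨(hx 0 2).2 (perm_lt_of_max hp (by decide)), (hx 1 2).2 (perm_lt_of_max hp (by decide))⟩

/-- For every `t ∈ {1,2,3}`, the pattern set `A_{3,t}` is shape-Wilf-equivalent to
`{213, 312}`. -/
theorem stmt6 (t : Fin 3) : ShapeWilfEquiv (Aset 3 t) {mkPattern ![1,0,2], mkPattern ![2,0,1]} := by
  intro n _ F
  simp only [fillingAvoidsSet_pair_iff]
  fin_cases t
  · simp only [Fin.zero_eta, fillingAvoidsSet_Aset_zero_iff]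
    exact card_goodFilling_eq hasTwoExtensions_max_first hasTwoExtensions_min_middle F
  · simp only [Fin.mk_one, fillingAvoidsSet_Aset_one_iff]
    exact card_goodFilling_eq hasTwoExtensions_max_middle hasTwoExtensions_min_middle F
  · simp only [Fin.reduceFinMk, fillingAvoidsSet_Aset_two_iff]
    exact card_goodFilling_eq hasTwoExtensions_max_last hasTwoExtensions_min_middle F
end

section
/- The pattern sets {123, 213} and {132, 213} are shape-Wilf-equivalent. -/
/-- An occurrence of a pattern of length three, in terms of its three columns. -/
lemma fillingContains_mkPattern_three {n : ℕ} (F : FerrersBoard n) (σ : Equiv.Perm (Fin n))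
    (v : Fin 3 → Fin 3) (h : Function.Bijective v) :
    FillingContains F σ (mkPattern v h) ↔ ∃ g : Fin 3 → Fin n, g 0 < g 1 ∧ g 1 < g 2 ∧
      (∀ a b : Fin 3, σ (g a) < σ (g b) ↔ v a < v b) ∧
      (∀ a b : Fin 3, (g a, σ (g b)) ∈ F.cells) := by
  constructor
  · rintro ⟨f, hf, h1, h2⟩
    exact ⟨f, hf (show (0 : Fin 3) < 1 by decide), hf (show (1 : Fin 3) < 2 by decide), h1, h2⟩
  · rintro ⟨g, h01, h12, h1, h2⟩
    refine ⟨g, ?_, h1, h2⟩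
    exact Fin.strictMono_iff_lt_succ.2 fun i => by fin_cases i <;> assumption

/-- A filling in which no rook has two rooks below it and to its left. -/
def ValidA {n : ℕ} (F : FerrersBoard n) (σ : Equiv.Perm (Fin n)) : Prop :=
  IsFilling F σ ∧ ∀ i j k, i < j → j < k → σ i < σ k → ¬ σ j < σ k

/-- A filling avoiding `132` and `213`, with the patterns spelled out. -/
def ValidB {n : ℕ} (F : FerrersBoard n) (σ : Equiv.Perm (Fin n)) : Prop :=
  IsFilling F σ ∧
    (∀ i j k, i < j → j < k → σ i < σ k → σ k < σ j → (k, σ j) ∉ F.cells) ∧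
    (∀ i j k, i < j → j < k → σ j < σ i → ¬ σ i < σ k)

lemma cells_of_corner {n : ℕ} (F : FerrersBoard n) (σ : Equiv.Perm (Fin n)) {i j k c : Fin n}
    (hij : i < j) (hjk : j < k) (hi : σ i ≤ σ c) (hj : σ j ≤ σ c) (hk : σ k ≤ σ c)
    (h : (k, σ c) ∈ F.cells) (a b : Fin 3) :
    (![i, j, k] a, σ (![i, j, k] b)) ∈ F.cells := by
  refine F.downward_closed h ?_ ?_
  · fin_cases a
    exacts [(hij.trans hjk).le, hjk.le, le_rfl]
  · fin_cases b <;> assumption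

lemma validA_iff {n : ℕ} (F : FerrersBoard n) (σ : Equiv.Perm (Fin n)) :
    (IsFilling F σ ∧ FillingAvoidsSet F σ {mkPattern ![0,1,2], mkPattern ![1,0,2]}) ↔
      ValidA F σ := by
  refine and_congr_right fun hF => ?_
  simp only [FillingAvoidsSet, Set.mem_insert_iff, Set.mem_singleton_iff, forall_eq_or_imp,
    forall_eq, fillingContains_mkPattern_three]
  constructor
  · rintro ⟨h1, h2⟩ i j k hij hjk hik hjk'
    rcases lt_trichotomy (σ i) (σ j) with h | h | h
    · refine h1 ⟨![i, j, k], hij, hjk, ?_, cells_of_corner F σ hij hjk hik.le hjk'.le le_rfl (hF k)⟩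
      intro a b
      fin_cases a <;> fin_cases b <;> simp <;> order
    · exact hij.ne (σ.injective h)
    · refine h2 ⟨![i, j, k], hij, hjk, ?_, cells_of_corner F σ hij hjk hik.le hjk'.le le_rfl (hF k)⟩
      intro a b
      fin_cases a <;> fin_cases b <;> simp <;> order
  · intro h
    constructor
    · rintro ⟨g, h01, h12, h1, -⟩
      exact h _ _ _ h01 h12 ((h1 0 2).2 (by decide)) ((h1 1 2).2 (by decide))
    · rintro ⟨g, h01, h12, h1, -⟩
      exact h _ _ _ h01 h12 ((h1 0 2).2 (by decide)) ((h1 1 2).2 (by decide))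

lemma validB_iff {n : ℕ} (F : FerrersBoard n) (σ : Equiv.Perm (Fin n)) :
    (IsFilling F σ ∧ FillingAvoidsSet F σ {mkPattern ![0,2,1], mkPattern ![1,0,2]}) ↔
      ValidB F σ := by
  refine and_congr_right fun hF => ?_
  simp only [FillingAvoidsSet, Set.mem_insert_iff, Set.mem_singleton_iff, forall_eq_or_imp,
    forall_eq, fillingContains_mkPattern_three]
  refine and_congr ⟨fun h1 i j k hij hjk hik hkj hc => ?_, ?_⟩
    ⟨fun h2 i j k hij hjk hji hik => ?_, ?_⟩
  · refine h1 ⟨![i, j, k], hij, hjk, ?_,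
      cells_of_corner F σ hij hjk (hik.trans hkj).le le_rfl hkj.le hc⟩
    intro a b
    fin_cases a <;> fin_cases b <;> simp <;> order
  · rintro h ⟨g, h01, h12, h1, h2⟩
    exact h _ _ _ h01 h12 ((h1 0 2).2 (by decide)) ((h1 2 1).2 (by decide)) (h2 2 1)
  · refine h2 ⟨![i, j, k], hij, hjk, ?_,
      cells_of_corner F σ hij hjk hik.le (hji.trans hik).le le_rfl (hF k)⟩
    intro a b
    fin_cases a <;> fin_cases b <;> simp <;> order
  · rintro h ⟨g, h01, h12, h1, h2⟩
    exact h _ _ _ h01 h12 ((h1 1 0).2 (by decide)) ((h1 0 2).2 (by decide))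

/-- The board obtained by deleting the last column and the bottom row. -/
def FerrersBoard.shrink {n : ℕ} (F : FerrersBoard (n + 1)) : FerrersBoard n where
  cells := {p | (p.1.castSucc, p.2.succ) ∈ F.cells}
  downward_closed := fun _ _ _ _ h hi hj =>
    F.downward_closed h (Fin.castSucc_le_castSucc_iff.2 hi) (Fin.succ_le_succ_iff.2 hj)

/-- Deleting any row that meets the last column gives the same board. -/
lemma mem_cells_succAbove_iff {n : ℕ} (F : FerrersBoard (n + 1)) {v : Fin (n + 1)}
    (hv : (Fin.last n, v) ∈ F.cells) (c r : Fin n) :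
    (c.castSucc, v.succAbove r) ∈ F.cells ↔ (c, r) ∈ F.shrink.cells := by
  rcases Fin.castSucc_lt_or_lt_succ v r with h | h
  · rw [Fin.succAbove_of_castSucc_lt _ _ h]
    have hle : r.succ ≤ v := h
    exact iff_of_true (F.downward_closed hv (Fin.le_last _) h.le)
      (F.downward_closed hv (Fin.le_last _) hle)
  · rw [Fin.succAbove_of_lt_succ _ _ h]
    rfl

/-- Add a last column, with its rook in row `v`, to a permutation. -/
def insertLast {n : ℕ} (p : Fin (n + 1) × Equiv.Perm (Fin n)) : Equiv.Perm (Fin (n + 1)) :=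
  ((finSuccEquiv' (Fin.last n)).trans p.2.optionCongr).trans (finSuccEquiv' p.1).symm

@[simp] lemma insertLast_last {n : ℕ} (p : Fin (n + 1) × Equiv.Perm (Fin n)) :
    insertLast p (Fin.last n) = p.1 := by
  simp [insertLast]

@[simp] lemma insertLast_castSucc {n : ℕ} (p : Fin (n + 1) × Equiv.Perm (Fin n)) (i : Fin n) :
    insertLast p i.castSucc = p.1.succAbove (p.2 i) := by
  simp [insertLast, finSuccEquiv'_last_apply_castSucc]

lemma insertLast_bijective (n : ℕ) :
    Function.Bijective (insertLast : Fin (n + 1) × Equiv.Perm (Fin n) → _) := by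
  rw [Fintype.bijective_iff_injective_and_card]
  refine ⟨?_, by simp [Fintype.card_perm, Nat.factorial_succ]⟩
  rintro ⟨v, τ⟩ ⟨w, ρ⟩ h
  obtain rfl : v = w := by simpa using congrArg (fun σ => σ (Fin.last n)) h
  refine Prod.ext rfl (Equiv.ext fun i => ?_)
  simpa using congrArg (fun σ => σ i.castSucc) h

lemma isFilling_insertLast {n : ℕ} (F : FerrersBoard (n + 1)) (v : Fin (n + 1))
    (τ : Equiv.Perm (Fin n)) :
    IsFilling F (insertLast (v, τ)) ↔ (Fin.last n, v) ∈ F.cells ∧ IsFilling F.shrink τ := by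
  unfold IsFilling
  rw [Fin.forall_fin_succ', and_comm]
  simp only [insertLast_last, insertLast_castSucc]
  exact and_congr_right fun hv => forall_congr' fun i => mem_cells_succAbove_iff F hv _ _

lemma validA_insertLast {n : ℕ} (F : FerrersBoard (n + 1)) (v : Fin (n + 1))
    (τ : Equiv.Perm (Fin n)) :
    ValidA F (insertLast (v, τ)) ↔
      ValidA F.shrink τ ∧ ((Fin.last n, v) ∈ F.cells ∧ (v : ℕ) ≤ 1) := by
  unfold ValidA
  rw [isFilling_insertLast]
  constructor
  · rintro ⟨⟨hv, hτ⟩, h⟩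
    refine ⟨⟨hτ, fun i j k hij hjk h1 h2 => ?_⟩, hv, ?_⟩
    · refine h i.castSucc j.castSucc k.castSucc hij hjk ?_ ?_ <;> simpa
    · by_contra! hv1
      have h0 : 0 < n := by omega
      have h1 : 1 < n := by omega
      obtain ⟨p, hp⟩ := τ.surjective ⟨0, h0⟩
      obtain ⟨q, hq⟩ := τ.surjective ⟨1, h1⟩
      have hp' : v.succAbove (τ p) < v := by
        rw [Fin.succAbove_lt_iff_castSucc_lt, hp]
        exact show 0 < (v : ℕ) by omega
      have hq' : v.succAbove (τ q) < v := by
        rw [Fin.succAbove_lt_iff_castSucc_lt, hq, Fin.lt_def]; simpa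
      have hpq : p ≠ q := by
        rintro rfl
        simp [hp] at hq
      rcases hpq.lt_or_gt with hlt | hlt
      · refine h p.castSucc q.castSucc (Fin.last n) hlt (Fin.castSucc_lt_last _) ?_ ?_ <;> simpa
      · refine h q.castSucc p.castSucc (Fin.last n) hlt (Fin.castSucc_lt_last _) ?_ ?_ <;> simpa
  · rintro ⟨⟨hτ, h⟩, hv, hv1⟩
    refine ⟨⟨hv, hτ⟩, fun i j k hij hjk => ?_⟩
    obtain ⟨j, rfl⟩ := Fin.exists_castSucc_eq.2 (hjk.trans_le (Fin.le_last _)).ne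
    obtain ⟨i, rfl⟩ := Fin.exists_castSucc_eq.2 (hij.trans (hjk.trans_le (Fin.le_last _))).ne
    induction k using Fin.lastCases with
    | last =>
      simp only [insertLast_last, insertLast_castSucc, Fin.succAbove_lt_iff_castSucc_lt]
      intro h1 h2
      refine (Fin.castSucc_lt_castSucc_iff.1 hij).ne (τ.injective (Fin.ext ?_))
      simp only [Fin.lt_def, Fin.val_castSucc] at h1 h2
      omega
    | cast k =>
      simpa using h i j k hij hjk

/-- The condition on the row `v` of the last rook under which adding it to `τ` creates neither
`132` nor `213`. -/
def Insertable {n : ℕ} (F : FerrersBoard (n + 1)) (v : Fin (n + 1)) (τ : Equiv.Perm (Fin n)) :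
    Prop :=
  (Fin.last n, v) ∈ F.cells ∧ (∀ i j, i < j → τ j < τ i → v ≤ (τ i).castSucc) ∧
    (∀ i j, i < j → (τ i).castSucc < v → v ≤ (τ j).castSucc →
      (Fin.last n, (τ j).succ) ∉ F.cells)

lemma validB_insertLast {n : ℕ} (F : FerrersBoard (n + 1)) (v : Fin (n + 1))
    (τ : Equiv.Perm (Fin n)) :
    ValidB F (insertLast (v, τ)) ↔ ValidB F.shrink τ ∧ Insertable F v τ := by
  unfold ValidB Insertable
  rw [isFilling_insertLast]
  constructor
  · rintro ⟨⟨hv, hτ⟩, h, h213⟩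
    refine ⟨⟨hτ, fun i j k hij hjk h1 h2 => ?_, fun i j k hij hjk h1 h2 => ?_⟩, hv,
      fun i j hij h1 => ?_, fun i j hij h1 h2 hc => ?_⟩
    · rw [← mem_cells_succAbove_iff F hv]
      simpa using h i.castSucc j.castSucc k.castSucc hij hjk (by simpa) (by simpa)
    · refine h213 i.castSucc j.castSucc k.castSucc hij hjk ?_ ?_ <;> simpa
    · by_contra! h2
      refine h213 i.castSucc j.castSucc (Fin.last n) hij (Fin.castSucc_lt_last _) (by simpa) ?_
      simpa [Fin.succAbove_lt_iff_castSucc_lt]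
    · refine h i.castSucc j.castSucc (Fin.last n) hij (Fin.castSucc_lt_last _) ?_ ?_ ?_
      · simpa [Fin.succAbove_lt_iff_castSucc_lt]
      · simpa [Fin.lt_succAbove_iff_le_castSucc]
      · simpa [Fin.succAbove_of_le_castSucc _ _ h2]
  · rintro ⟨⟨hτ, h, h213⟩, hv, h1, h2⟩
    refine ⟨⟨hv, hτ⟩, fun i j k hij hjk => ?_, fun i j k hij hjk => ?_⟩
    all_goals
      obtain ⟨j, rfl⟩ := Fin.exists_castSucc_eq.2 (hjk.trans_le (Fin.le_last _)).ne
      obtain ⟨i, rfl⟩ := Fin.exists_castSucc_eq.2 (hij.trans (hjk.trans_le (Fin.le_last _))).ne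
      induction k using Fin.lastCases with
      | last => ?_
      | cast k => ?_
    · simp only [insertLast_last, insertLast_castSucc, Fin.succAbove_lt_iff_castSucc_lt,
        Fin.lt_succAbove_iff_le_castSucc]
      intro h3 h4
      rw [Fin.succAbove_of_le_castSucc _ _ h4]
      exact h2 i j hij h3 h4
    · simp only [insertLast_castSucc, mem_cells_succAbove_iff F hv,
        Fin.succAbove_lt_succAbove_iff]
      exact h i j k hij hjk
    · simp only [insertLast_last, insertLast_castSucc, Fin.succAbove_lt_iff_castSucc_lt,
        Fin.succAbove_lt_succAbove_iff, not_lt]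
      exact h1 i j hij
    · simp only [insertLast_castSucc, Fin.succAbove_lt_succAbove_iff]
      exact h213 i j k hij hjk

/-- If the last column has at least two cells, then besides the bottom row there is exactly one
row where a rook can be inserted in the last column. -/
lemma exists_insertable_iff {n : ℕ} (F : FerrersBoard (n + 1)) (τ : Equiv.Perm (Fin n))
    (hτ : ValidB F.shrink τ) {u : Fin (n + 1)} (hu : (u : ℕ) = 1)
    (huF : (Fin.last n, u) ∈ F.cells) :
    ∃ k : Fin (n + 1), k ≠ 0 ∧ ∀ v, Insertable F v τ ↔ v = 0 ∨ v = k := by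
  classical
  obtain ⟨-, h132, h213⟩ := hτ
  let S : Finset (Fin (n + 1)) := Finset.univ.filter fun v =>
    (Fin.last n, v) ∈ F.cells ∧ ∀ i j, i < j → τ j < τ i → v ≤ (τ i).castSucc
  have huS : u ∈ S := by
    simp only [S, Finset.mem_filter, Finset.mem_univ, true_and]
    refine ⟨huF, fun i j _ h => ?_⟩
    simp only [Fin.lt_def, Fin.le_def, Fin.val_castSucc] at h ⊢
    omega
  obtain ⟨k, hkS, hmax⟩ : ∃ k ∈ S, ∀ v ∈ S, v ≤ k :=
    ⟨S.max' ⟨u, huS⟩, S.max'_mem _, fun v hv => S.le_max' v hv⟩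
  have huk := hmax u huS
  simp only [S, Finset.mem_filter, Finset.mem_univ, true_and] at hkS hmax
  obtain ⟨hkF, hk⟩ := hkS
  have hk0 : k ≠ 0 := by
    rintro rfl
    rw [Fin.le_def, hu] at huk
    simp at huk
  refine ⟨k, hk0, fun v => ⟨fun ⟨hvF, hv1, hv2⟩ => ?_, ?_⟩⟩
  · have hvk := hmax v ⟨hvF, hv1⟩
    by_contra! hne
    have hlt : v < k := lt_of_le_of_ne hvk hne.2
    have hv0 : (v : ℕ) ≠ 0 := fun h => hne.1 (Fin.ext h)
    have hvn : (v : ℕ) < n := by have := k.isLt; rw [Fin.lt_def] at hlt; omega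
    obtain ⟨p, hp⟩ := τ.surjective ⟨0, by omega⟩
    obtain ⟨q, hq⟩ := τ.surjective ⟨v, hvn⟩
    have hpq : p < q := by
      rcases lt_trichotomy p q with h | h | h
      · exact h
      · subst h
        rw [hp, Fin.mk.injEq] at hq
        omega
      · have := hk q p h (by rw [hp, hq, Fin.lt_def]; simpa using Nat.pos_of_ne_zero hv0)
        rw [hq] at this
        exact absurd hlt this.not_gt
    refine hv2 p q hpq ?_ ?_ (F.downward_closed hkF le_rfl ?_)
    · rw [hp, Fin.lt_def]; simpa using Nat.pos_of_ne_zero hv0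
    · rw [hq]; exact le_rfl
    · rw [hq]; exact hlt
  · rintro (rfl | rfl)
    · exact ⟨F.downward_closed hkF le_rfl (Fin.zero_le _), fun _ _ _ _ => Fin.zero_le _,
        fun i j _ h => absurd h (Fin.not_lt_zero _)⟩
    · refine ⟨hkF, hk, fun i j hij hi hj hc => ?_⟩
      have hvn : (v : ℕ) < n := lt_of_le_of_lt hj (τ j).isLt
      obtain ⟨w, rfl⟩ : ∃ w : Fin n, w.castSucc = v := ⟨⟨v, hvn⟩, rfl⟩
      simp only [Fin.castSucc_lt_castSucc_iff, Fin.castSucc_le_castSucc_iff] at hi hj hk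
      have hwF : (Fin.last n, w.succ) ∈ F.cells :=
        F.downward_closed hc le_rfl (Fin.succ_le_succ_iff.2 hj)
      have hnot : ¬ ∀ i j, i < j → τ j < τ i → w.succ ≤ (τ i).castSucc :=
        fun h => (hmax w.succ ⟨hwF, h⟩).not_gt Fin.castSucc_lt_succ
      push Not at hnot
      obtain ⟨p, q, hpq, hlt, hle⟩ := hnot
      have hp : τ p = w := le_antisymm (Fin.lt_def.1 hle |> Nat.le_of_lt_succ) (hk p q hpq hlt)
      subst hp
      rcases lt_trichotomy i p with hip | rfl | hip
      · have hiq : τ i < τ q := by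
          rcases lt_trichotomy (τ i) (τ q) with h | h | h
          · exact h
          · exact absurd (τ.injective h) (hip.trans hpq).ne
          · exact absurd (hk i q (hip.trans hpq) h) hi.not_ge
        exact h132 i p q hip hpq hiq hlt (F.downward_closed hwF (Fin.le_last _) le_rfl)
      · exact lt_irrefl _ hi
      · refine h213 p i j hip hij hi (lt_of_le_of_ne hj fun h => ?_)
        exact (hip.trans hij).ne (τ.injective h)

lemma card_insertable {n : ℕ} (F : FerrersBoard (n + 1)) (τ : Equiv.Perm (Fin n))
    (hτ : ValidB F.shrink τ) :
    Nat.card {v // Insertable F v τ} =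
      Nat.card {v : Fin (n + 1) // (Fin.last n, v) ∈ F.cells ∧ (v : ℕ) ≤ 1} := by
  by_cases hu : ∃ u : Fin (n + 1), (u : ℕ) = 1 ∧ (Fin.last n, u) ∈ F.cells
  · obtain ⟨u, hu, huF⟩ := hu
    obtain ⟨k, hk0, hk⟩ := exists_insertable_iff F τ hτ hu huF
    have hu0 : u ≠ 0 := by
      rintro rfl
      simp at hu
    have hset : ∀ v : Fin (n + 1), ((Fin.last n, v) ∈ F.cells ∧ (v : ℕ) ≤ 1) ↔ v = 0 ∨ v = u := by
      intro v
      constructor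
      · rintro ⟨-, hv⟩
        simp only [Fin.ext_iff, Fin.val_zero]
        omega
      · rintro (rfl | rfl)
        · exact ⟨F.downward_closed huF le_rfl (Fin.zero_le _), by simp⟩
        · exact ⟨huF, hu.le⟩
    simp only [hk, hset]
    exact (Set.ncard_pair hk0.symm).trans (Set.ncard_pair hu0.symm).symm
  · push Not at hu
    refine Nat.card_congr (Equiv.subtypeEquivRight fun v => ?_)
    have hzero : (Fin.last n, v) ∈ F.cells → (v : ℕ) = 0 := by
      intro hv
      by_contra h0
      exact hu ⟨1, by omega⟩ rfl
        (F.downward_closed hv le_rfl (Fin.le_def.2 (Nat.one_le_iff_ne_zero.2 h0)))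
    constructor
    · exact fun h => ⟨h.1, by have := hzero h.1; omega⟩
    · rintro ⟨hv, -⟩
      obtain rfl : v = 0 := Fin.ext (hzero hv)
      exact ⟨hv, fun _ _ _ _ => Fin.zero_le _, fun i j _ h => absurd h (Fin.not_lt_zero _)⟩

lemma card_eq_mul_of_fiber {α β γ : Type*} [Fintype α] [Fintype β] {f : α × β → γ}
    (hf : f.Bijective) {P : γ → Prop} {Q : β → Prop} {C : α → β → Prop} {K : ℕ}
    (hP : ∀ a b, P (f (a, b)) ↔ Q b ∧ C a b) (hK : ∀ b, Q b → Nat.card {a // C a b} = K) :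
    Nat.card {c // P c} = Nat.card {b // Q b} * K := by
  classical
  let e : (Σ b : {b // Q b}, {a // C a b}) ≃ {p : α × β // P (f p)} :=
    { toFun := fun x => ⟨(x.2.1, x.1.1), (hP _ _).2 ⟨x.1.2, x.2.2⟩⟩
      invFun := fun p => ⟨⟨p.1.2, ((hP _ _).1 p.2).1⟩, ⟨p.1.1, ((hP _ _).1 p.2).2⟩⟩
      left_inv := fun _ => rfl
      right_inv := fun _ => rfl }
  have e' : {p : α × β // P (f p)} ≃ {c // P c} :=
    (Equiv.ofBijective f hf).subtypeEquiv fun _ => Iff.rfl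
  rw [← Nat.card_congr (e.trans e'), Nat.card_sigma, Finset.sum_congr rfl fun b _ => hK b.1 b.2]
  simp

lemma card_validA_eq_card_validB (n : ℕ) (F : FerrersBoard n) :
    Nat.card {σ // ValidA F σ} = Nat.card {σ // ValidB F σ} := by
  induction n with
  | zero =>
    refine Nat.card_congr (Equiv.subtypeEquivRight fun σ => ?_)
    exact iff_of_true ⟨fun i => i.elim0, fun i => i.elim0⟩
      ⟨fun i => i.elim0, fun i => i.elim0, fun i => i.elim0⟩
  | succ n ih =>
    rw [card_eq_mul_of_fiber (insertLast_bijective n) (validA_insertLast F) fun _ _ => rfl,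
      card_eq_mul_of_fiber (insertLast_bijective n) (validB_insertLast F) (card_insertable F), ih]

/-- The pattern sets {123, 213} and {132, 213} are shape-Wilf-equivalent. -/
theorem stmt7 : ShapeWilfEquiv {mkPattern ![0,1,2], mkPattern ![1,0,2]} {mkPattern ![0,2,1], mkPattern ![1,0,2]} := by
  intro n _ F
  simp only [validA_iff, validB_iff]
  exact card_validA_eq_card_validB n F
end
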